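/- Let G=(V,E) be a finite simple planar graph with a straight-line planar embedding v : V → ℂ, let θ : E → ℝ with w_{ij} = tanh θ_{ij}, let A, D, W = AD be the Kac–Ward matrices, assume I − W is invertible, and set S = (I−W)^{−1} A and T = (I+P)(S ∘ Sᵀ)(I+Pᵀ), where ∘ is the entrywise (Hadamard) product and P is the permutation matrix swapping each directed edge (i,j) with its reversal (j,i). Then for all distinct edges {i,j} ≠ {k,l} of G, the Hessian of the log-partition function Φ(θ) of the zero-field Ising model satisfies ∂²Φ(θ)/∂θ_{ij}∂θ_{kl} = −(1/2)(1 − w_{ij}²) · T_{(i,j),(k,l)} · (1 − w_{kl}²). -/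

import Mathlib

noncomputable section

/-- The spin value ±1 associated to a Boolean. -/
def spin (b : Bool) : ℝ := if b then 1 else -1

variable {V : Type*} [Fintype V] [DecidableEq V]

/-- The product σᵢσⱼ over an unordered pair. -/
def pairProd (σ : V → ℝ) : Sym2 V → ℝ :=
  Sym2.lift ⟨fun i j => σ i * σ j, fun i j => mul_comm (σ i) (σ j)⟩

/-- Energy (exponent) of an Ising model with vertex parameters θv and edge parameters θe. -/
def energy (G : SimpleGraph V) [DecidableRel G.Adj]
    (θv : V → ℝ) (θe : Sym2 V → ℝ) (x : V → Bool) : ℝ :=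
  ∑ i, θv i * spin (x i) + ∑ e ∈ G.edgeFinset, θe e * pairProd (fun i => spin (x i)) e

/-- Partition function of the Ising model. -/
def partitionFn (G : SimpleGraph V) [DecidableRel G.Adj]
    (θv : V → ℝ) (θe : Sym2 V → ℝ) : ℝ :=
  ∑ x : V → Bool, Real.exp (energy G θv θe x)

/-- Probability mass function of the Ising model. -/
def isingProb (G : SimpleGraph V) [DecidableRel G.Adj]
    (θv : V → ℝ) (θe : Sym2 V → ℝ) (x : V → Bool) : ℝ :=
  Real.exp (energy G θv θe x) / partitionFn G θv θe

/-- Pair moment E_θ[x_i x_j]. -/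
def momentPair (G : SimpleGraph V) [DecidableRel G.Adj]
    (θv : V → ℝ) (θe : Sym2 V → ℝ) (i j : V) : ℝ :=
  ∑ x : V → Bool, isingProb G θv θe x * spin (x i) * spin (x j)

/-- Single-site moment (mean) E_θ[x_i]. -/
def momentSingle (G : SimpleGraph V) [DecidableRel G.Adj]
    (θv : V → ℝ) (θe : Sym2 V → ℝ) (i : V) : ℝ :=
  ∑ x : V → Bool, isingProb G θv θe x * spin (x i)


section KWabstract
set_option linter.unusedSectionVars false
set_option linter.unusedSimpArgs false
set_option linter.unnecessarySeqFocus false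
open scoped Classical

/-- Combinatorial data of a planar straight-line graph swept from left to right. -/
structure SweepData (U E : Type*) where
  l : E → U
  r : E → U
  x : U → ℝ
  hx : Function.Injective x
  hlr : ∀ e, x (l e) < x (r e)
  Bel : E → E → Prop
  key : E → ℝ
  bel_irrefl : ∀ e, ¬ Bel e e
  bel_ov : ∀ e f, Bel e f → x (l e) < x (r f) ∧ x (l f) < x (r e)
  bel_tot : ∀ e f, e ≠ f → x (l e) < x (r f) → x (l f) < x (r e) → (Bel e f ↔ ¬ Bel f e)
  bel_vert : ∀ e f g u, (u = l f ∨ u = r f) → (u = l g ∨ u = r g) →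
    x (l e) < x u → x u < x (r e) → (Bel f e ↔ Bel g e)
  key_l : ∀ e f, l e = l f → (Bel e f ↔ key e < key f)
  key_r : ∀ e f, r e = r f → (Bel e f ↔ key f < key e)

namespace SweepData

variable {U E : Type*} [Fintype U] [DecidableEq U] [Fintype E] [DecidableEq E]

/-- Mirror image. -/
def mirror (K : SweepData U E) : SweepData U E where
  l := K.r
  r := K.l
  x := fun u => - K.x u
  hx := fun a b h => K.hx (by simpa using h)
  hlr := fun e => by simpa using K.hlr e
  Bel := K.Bel
  key := fun e => - K.key e
  bel_irrefl := K.bel_irrefl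
  bel_ov := fun e f h => by
    have := K.bel_ov e f h
    constructor <;> linarith
  bel_tot := fun e f h h1 h2 => K.bel_tot e f h (by linarith) (by linarith)
  bel_vert := fun e f g u hf hg h1 h2 =>
    K.bel_vert e f g u hf.symm hg.symm (by linarith) (by linarith)
  key_l := fun e f h => by rw [K.key_r e f h]; simp
  key_r := fun e f h => by rw [K.key_l e f h]; simp

/-- sign character of `ZMod 2` -/
def chi (z : ZMod 2) : ℝ := if z = 0 then 1 else -1

lemma chi_add (a b : ZMod 2) : chi (a + b) = chi a * chi b := by
  have e1 : ∀ y : ZMod 2, y = 0 ∨ y = 1 := by decide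
  have e2 : (1 : ZMod 2) + 1 = 0 := by decide
  rcases e1 a with rfl | rfl <;> rcases e1 b with rfl | rfl <;> simp [chi, e2]

@[simp] lemma chi_zero : chi 0 = 1 := by simp [chi]
@[simp] lemma chi_one : chi 1 = -1 := by simp [chi]

/-- indicator in `ZMod 2` -/
def ind (p : Prop) : ZMod 2 := if p then 1 else 0

@[simp] lemma ind_true : ind True = 1 := by simp [ind]
@[simp] lemma ind_false : ind False = 0 := by simp [ind]
lemma ind_pos {p : Prop} (h : p) : ind p = 1 := by simp [ind, h]
lemma ind_neg {p : Prop} (h : ¬ p) : ind p = 0 := by simp [ind, h]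

lemma chi_card (n : ℕ) : chi (n : ZMod 2) = (-1 : ℝ) ^ n := by
  induction n with
  | zero => simp
  | succ n ih => push_cast; rw [chi_add, ih]; simp [pow_succ]

/-- alternating sum over a finite linearly ordered set -/
lemma alt_sum (κ : E → ℝ) (S : Finset E) (hinj : ∀ e ∈ S, ∀ f ∈ S, κ e = κ f → e = f) :
    ∑ e ∈ S, chi (∑ f ∈ S, ind (κ f < κ e)) = if (S.card : ZMod 2) = 1 then 1 else 0 := by
  induction S using Finset.induction_on_max_value κ with
  | empty => simp
  | insert a s ha hmax ih =>
    have hlt : ∀ y ∈ s, κ y < κ a := fun y hy => lt_of_le_of_ne (hmax y hy) (fun h =>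
      ha ((hinj y (by simp [hy]) a (by simp) h) ▸ hy))
    rw [Finset.sum_insert ha]
    have h1 : ∑ e ∈ s, chi (∑ f ∈ insert a s, ind (κ f < κ e)) =
        ∑ e ∈ s, chi (∑ f ∈ s, ind (κ f < κ e)) := by
      refine Finset.sum_congr rfl fun e he => ?_
      rw [Finset.sum_insert ha, ind_neg (not_lt.2 (hlt e he).le), zero_add]
    rw [h1, ih (fun e he f hf => hinj e (by simp [he]) f (by simp [hf])),
      Finset.sum_insert ha, ind_neg (lt_irrefl _), zero_add,
      Finset.sum_congr rfl (fun f hf => ind_pos (hlt f hf)), Finset.card_insert_of_notMem ha]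
    simp only [Finset.sum_const, nsmul_eq_mul, mul_one, Nat.cast_add, Nat.cast_one]
    generalize (s.card : ZMod 2) = z
    have : z = 0 ∨ z = 1 := by revert z; decide
    rcases this with rfl | rfl
    · simp
    · have : (1 : ZMod 2) + 1 = 0 := by decide
      simp [this]

/-- the same-side part of the vertex identity -/
lemma alt_sum_side (κ : E → ℝ) (S : Finset E) (h : E)
    (hinj : ∀ e ∈ insert h S, ∀ f ∈ insert h S, κ e = κ f → e = f) :
    ∑ e ∈ S, (if e = h then 0 else (if κ h < κ e then 1 else -1) *
      chi (∑ f ∈ S, ind (κ f < κ e))) =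
    (if (S.card : ZMod 2) = 1 then 1 else 0) - 1 +
      (if h ∈ S then 0 else chi (∑ f ∈ S, ind (κ f < κ h))) := by
  have hS : ∀ e ∈ S, ∀ f ∈ S, κ e = κ f → e = f := fun e he f hf =>
    hinj e (by simp [he]) f (by simp [hf])
  have h1 := alt_sum κ S hS
  have h2 := alt_sum κ (S.filter (fun e => κ e < κ h)) (fun e he f hf =>
    hS e (Finset.mem_of_mem_filter _ he) f (Finset.mem_of_mem_filter _ hf))
  have h3 : ∑ e ∈ S.filter (fun e => κ e < κ h),
      chi (∑ f ∈ S.filter (fun e => κ e < κ h), ind (κ f < κ e)) =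
      ∑ e ∈ S, if κ e < κ h then chi (∑ f ∈ S, ind (κ f < κ e)) else 0 := by
    rw [Finset.sum_filter]
    refine Finset.sum_congr rfl fun e _ => ?_
    split_ifs with he
    · congr 1
      rw [Finset.sum_filter]
      refine Finset.sum_congr rfl fun f _ => ?_
      split_ifs with hf
      · rfl
      · rw [ind_neg]; intro h'; exact hf (h'.trans he)
    · rfl
  rw [h3] at h2
  have h4 : (((S.filter (fun e => κ e < κ h)).card : ℕ) : ZMod 2) = ∑ f ∈ S, ind (κ f < κ h) := by
    simp [ind, Finset.sum_boole]
  rw [h4] at h2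
  have h5 : ∑ e ∈ S, (if e = h then 0 else (if κ h < κ e then 1 else -1) *
      chi (∑ f ∈ S, ind (κ f < κ e))) = 
      ∑ e ∈ S, chi (∑ f ∈ S, ind (κ f < κ e)) 
      - 2 * (∑ e ∈ S, if κ e < κ h then chi (∑ f ∈ S, ind (κ f < κ e)) else 0)
      - ∑ e ∈ S, if e = h then chi (∑ f ∈ S, ind (κ f < κ e)) else 0 := by
    rw [Finset.mul_sum, ← Finset.sum_sub_distrib, ← Finset.sum_sub_distrib]
    refine Finset.sum_congr rfl fun e he => ?_
    by_cases heh : e = h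
    · subst heh; simp
    · have hne : κ e ≠ κ h := fun h' => heh (hinj e (by simp [he]) h (by simp) h')
      rcases lt_or_gt_of_ne hne with hl | hl
      · simp [heh, hl, not_lt.2 hl.le]; ring
      · simp [heh, hl, not_lt.2 hl.le]
  rw [h5, h1, h2, Finset.sum_ite_eq']
  generalize (∑ f ∈ S, ind (κ f < κ h)) = z
  have : z = 0 ∨ z = 1 := by revert z; decide
  rcases this with rfl | rfl <;> by_cases hh : h ∈ S <;> simp [hh] <;> ring

variable (K : SweepData U E)

def src (d : E × Bool) : U := if d.2 then K.l d.1 else K.r d.1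
def tgt (d : E × Bool) : U := if d.2 then K.r d.1 else K.l d.1

/-- real Kac-Ward transition matrix -/
def B (d d' : E × Bool) : ℝ :=
  if K.tgt d = K.src d' ∧ d.1 ≠ d'.1 then
    (if d.2 = d'.2 then 1 else if K.Bel d.1 d'.1 then 1 else -1) else 0

/-- boundary mod 2 -/
def bd (F : Finset E) (u : U) : ZMod 2 := ∑ f ∈ F, (ind (K.l f = u) + ind (K.r f = u))

/-- `f` is below `d` near the source of `d` -/
def nb (f : E) (d : E × Bool) : ZMod 2 :=
  ind (K.Bel f d.1 ∧ if d.2 then K.x (K.l f) ≤ K.x (K.l d.1) else K.x (K.r d.1) ≤ K.x (K.r f))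

def N (F : Finset E) (d : E × Bool) : ZMod 2 := ∑ f ∈ F, K.nb f d

/-- vertex `u` is below edge `e` -/
def VBP (u : U) (e : E) : Prop := K.x (K.l e) < K.x u ∧ K.x u < K.x (K.r e) ∧
  ∃ g, (u = K.l g ∨ u = K.r g) ∧ K.Bel g e

lemma nb_add (e f : E) : K.nb f (e, true) + K.nb f (e, false) =
    ind (K.VBP (K.l f) e) + ind (K.VBP (K.r f) e) := by
  by_cases h : K.Bel f e
  · have ov := K.bel_ov f e h
    have h1 : K.VBP (K.l f) e ↔ ¬ (K.x (K.l f) ≤ K.x (K.l e)) := by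
      constructor
      · intro h'; exact not_le.2 h'.1
      · intro h'; exact ⟨not_le.1 h', ov.1, f, Or.inl rfl, h⟩
    have h2 : K.VBP (K.r f) e ↔ ¬ (K.x (K.r e) ≤ K.x (K.r f)) := by
      constructor
      · intro h'; exact not_le.2 h'.2.1
      · intro h'; exact ⟨ov.2, not_le.1 h', f, Or.inr rfl, h⟩
    rw [h1, h2]
    by_cases a : K.x (K.l f) ≤ K.x (K.l e) <;> by_cases b : K.x (K.r e) ≤ K.x (K.r f) <;>
      simp [nb, h, a, b] <;> decide
  · have h1 : ¬ K.VBP (K.l f) e := fun ⟨a, b, g, hg, hb⟩ =>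
      h ((K.bel_vert e f g _ (Or.inl rfl) hg a b).2 hb)
    have h2 : ¬ K.VBP (K.r f) e := fun ⟨a, b, g, hg, hb⟩ =>
      h ((K.bel_vert e f g _ (Or.inr rfl) hg a b).2 hb)
    simp [nb, h, h1, h2]

lemma N_add (F : Finset E) (e : E) : K.N F (e, true) + K.N F (e, false) =
    ∑ u, ind (K.VBP u e) * K.bd F u := by
  unfold N bd
  rw [← Finset.sum_add_distrib]
  simp_rw [nb_add, Finset.mul_sum]
  rw [Finset.sum_comm]
  refine Finset.sum_congr rfl fun f _ => ?_
  simp_rw [mul_add]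
  rw [Finset.sum_add_distrib]
  simp [ind]

lemma N_add' (F : Finset E) (e : E) (p q : U)
    (h : ∀ u, K.bd F u = ind (u = p) + ind (u = q)) : K.N F (e, true) + K.N F (e, false) =
    ind (K.VBP p e) + ind (K.VBP q e) := by
  rw [N_add]
  simp_rw [h, mul_add]
  rw [Finset.sum_add_distrib]
  simp [ind]

/-- sum over spanning edges below the vertex -/
def C (H : Finset E) (v : U) : ZMod 2 :=
  ∑ f ∈ H, ind (K.x (K.l f) < K.x v ∧ K.x v < K.x (K.r f) ∧ ¬ K.VBP v f)

lemma not_bel_iff (f e : E) (v : U) (hv : v = K.l e ∨ v = K.r e)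
    (h1 : K.x (K.l f) < K.x v) (h2 : K.x v < K.x (K.r f)) : K.Bel f e ↔ ¬ K.VBP v f := by
  have hne : f ≠ e := by rintro rfl; rcases hv with rfl | rfl <;> simp at h1 h2
  have hlr := K.hlr e
  have : K.x (K.l e) ≤ K.x v ∧ K.x v ≤ K.x (K.r e) := by
    rcases hv with rfl | rfl <;> constructor <;> linarith
  rw [K.bel_tot f e hne (by linarith) (by linarith), not_iff_not]
  constructor
  · intro h; exact ⟨h1, h2, e, hv, h⟩
  · rintro ⟨_, _, g, hg, hb⟩
    exact (K.bel_vert f e g v hv hg h1 h2).2 hb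

lemma N_true (H : Finset E) (e : E) : K.N H (e, true) = K.C H (K.l e) +
    ∑ f ∈ H.filter (fun f => K.l f = K.l e), ind (K.key f < K.key e) := by
  unfold N C
  rw [Finset.sum_filter, ← Finset.sum_add_distrib]
  refine Finset.sum_congr rfl fun f _ => ?_
  by_cases h : K.l f = K.l e
  · simp [nb, h, K.key_l f e h]
  · have hx : K.x (K.l f) ≠ K.x (K.l e) := fun h' => h (K.hx h')
    simp only [nb, h, if_true, if_false, add_zero]
    congr 1
    apply propext
    constructor
    · rintro ⟨hb, hle⟩
      have ov := K.bel_ov f e hb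
      have hlt := lt_of_le_of_ne hle hx
      exact ⟨hlt, ov.2, (K.not_bel_iff f e _ (Or.inl rfl) hlt ov.2).1 hb⟩
    · rintro ⟨a, b, c⟩
      exact ⟨(K.not_bel_iff f e _ (Or.inl rfl) a b).2 c, a.le⟩

lemma N_false (H : Finset E) (e : E) : K.N H (e, false) = K.C H (K.r e) +
    ∑ f ∈ H.filter (fun f => K.r f = K.r e), ind (- K.key f < - K.key e) := by
  unfold N C
  rw [Finset.sum_filter, ← Finset.sum_add_distrib]
  refine Finset.sum_congr rfl fun f _ => ?_
  by_cases h : K.r f = K.r e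
  · simp [nb, h, K.key_r f e h]
  · have hx : K.x (K.r e) ≠ K.x (K.r f) := fun h' => h (K.hx h').symm
    simp only [nb, h, if_false, add_zero]
    congr 1
    apply propext
    simp only [Bool.false_eq_true, if_false]
    constructor
    · rintro ⟨hb, hle⟩
      have ov := K.bel_ov f e hb
      have hlt := lt_of_le_of_ne hle hx
      exact ⟨ov.1, hlt, (K.not_bel_iff f e _ (Or.inr rfl) ov.1 hlt).1 hb⟩
    · rintro ⟨a, b, c⟩
      exact ⟨(K.not_bel_iff f e _ (Or.inr rfl) a b).2 c, b.le⟩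

lemma key_inj_l {e f : E} (h : K.l e = K.l f) (hk : K.key e = K.key f) : e = f := by
  by_contra hne
  have := K.bel_tot e f hne (by rw [h]; exact K.hlr f) (by rw [← h]; exact K.hlr e)
  rw [K.key_l e f h, K.key_l f e h.symm, hk] at this
  simp at this

lemma key_inj_r {e f : E} (h : K.r e = K.r f) (hk : K.key e = K.key f) : e = f := by
  by_contra hne
  have := K.bel_tot e f hne (by rw [← h]; exact K.hlr e) (by rw [h]; exact K.hlr f)
  rw [K.key_r e f h, K.key_r f e h.symm, hk] at this
  simp at this

lemma bd_card (H : Finset E) (v : U) : K.bd H v =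
    ((H.filter (fun f => K.l f = v)).card : ZMod 2) + ((H.filter (fun f => K.r f = v)).card : ZMod 2) := by
  unfold bd
  rw [Finset.sum_add_distrib, Finset.card_filter, Finset.card_filter]
  push_cast
  congr 1 <;> refine Finset.sum_congr rfl fun f _ => ?_
  · by_cases h : K.l f = v <;> simp [ind, h]
  · by_cases h : K.r f = v <;> simp [ind, h]

def rev (d : E × Bool) : E × Bool := (d.1, !d.2)

lemma local_id (H : Finset E) (d : E × Bool) (hodd : K.bd H (K.tgt d) = 1) :
    ∑ d' : E × Bool, K.B d d' * (if d'.1 ∈ H then chi (K.N H d') else 0) =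
    if d.1 ∈ H then 0 else chi (K.N H (rev d)) := by
  obtain ⟨h, s⟩ := d
  rw [Fintype.sum_prod_type]
  simp only [Fintype.sum_bool]
  rw [Finset.sum_add_distrib]
  have e1 : ∀ y : ZMod 2, y = 0 ∨ y = 1 := by decide
  have e2 : (1 : ZMod 2) + 1 = 0 := by decide
  cases s
  · -- v = l h
    set v := K.l h with hv
    have htg : K.tgt (h, false) = v := by simp [tgt, hv]
    rw [htg, bd_card] at hodd
    have hR := alt_sum_side K.key (H.filter (fun f => K.l f = v)) h (by
      intro e he f hf
      have a : ∀ e ∈ insert h (H.filter (fun f => K.l f = v)), K.l e = v := by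
        intro e he
        rcases Finset.mem_insert.1 he with rfl | he
        · rfl
        · exact (Finset.mem_filter.1 he).2
      exact K.key_inj_l ((a e he).trans (a f hf).symm))
    have hL := alt_sum (fun e => - K.key e) (H.filter (fun f => K.r f = v)) (by
      intro e he f hf hk
      exact K.key_inj_r ((Finset.mem_filter.1 he).2.trans (Finset.mem_filter.1 hf).2.symm)
        (neg_injective hk))
    have s1 : ∑ e, K.B (h, false) (e, true) * (if e ∈ H then chi (K.N H (e, true)) else 0) =
      chi (K.C H v) * ∑ e ∈ H.filter (fun f => K.l f = v), (if e = h then 0 else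
        (if K.key h < K.key e then 1 else -1) *
        chi (∑ f ∈ H.filter (fun f => K.l f = v), ind (K.key f < K.key e))) := by
      rw [Finset.mul_sum, Finset.sum_filter, ← Finset.sum_filter_add_sum_filter_not Finset.univ (· ∈ H)]
      rw [Finset.sum_eq_zero (s := Finset.univ.filter (fun e => ¬ e ∈ H)), add_zero]
      · rw [Finset.filter_mem_eq_inter, Finset.univ_inter]
        refine Finset.sum_congr rfl fun e he => ?_
        by_cases hle : K.l e = v
        · by_cases heh : e = h
          · simp [B, heh]
          · have : h ≠ e := Ne.symm heh
            simp only [B, tgt, src, if_pos he, N_true, chi_add, hle, heh, this, ← hv,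
              K.key_l h e (hv ▸ hle.symm)]
            simp [this]
        · have : v ≠ K.l e := Ne.symm hle
          simp [B, tgt, src, hle, ← hv, this]
      · intro e he
        simp [(Finset.mem_filter.1 he).2]
    have s2 : ∑ e, K.B (h, false) (e, false) * (if e ∈ H then chi (K.N H (e, false)) else 0) =
      chi (K.C H v) * ∑ e ∈ H.filter (fun f => K.r f = v), 
        chi (∑ f ∈ H.filter (fun f => K.r f = v), ind (-K.key f < -K.key e)) := by
      rw [Finset.mul_sum, Finset.sum_filter, ← Finset.sum_filter_add_sum_filter_not Finset.univ (· ∈ H)]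
      rw [Finset.sum_eq_zero (s := Finset.univ.filter (fun e => ¬ e ∈ H)), add_zero]
      · rw [Finset.filter_mem_eq_inter, Finset.univ_inter]
        refine Finset.sum_congr rfl fun e he => ?_
        by_cases hle : K.r e = v
        · have : h ≠ e := by
            rintro rfl
            have := K.hlr h
            rw [hle] at this
            exact lt_irrefl _ this
          simp only [B, tgt, src, if_pos he, N_false, chi_add, hle, this, ← hv]
          simp [this]
        · have : v ≠ K.r e := Ne.symm hle
          simp [B, tgt, src, hle, ← hv, this]
      · intro e he
        simp [(Finset.mem_filter.1 he).2]
    rw [s1, s2, hR, hL]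
    simp only [rev, Bool.not_false, N_true, chi_add, ← hv, Finset.mem_filter]
    rcases e1 ((H.filter (fun f => K.l f = v)).card : ZMod 2) with a | a <;>
    rcases e1 ((H.filter (fun f => K.r f = v)).card : ZMod 2) with b | b <;>
    rw [a, b] at hodd ⊢ <;> simp [e2] at hodd ⊢ <;> by_cases hh : h ∈ H <;> simp [hh, hv] <;> try ring
  · set v := K.r h with hv
    have htg : K.tgt (h, true) = v := by simp [tgt, hv]
    rw [htg, bd_card] at hodd
    have hR := alt_sum_side (fun e => - K.key e) (H.filter (fun f => K.r f = v)) h (by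
      intro e he f hf hk
      have a : ∀ e ∈ insert h (H.filter (fun f => K.r f = v)), K.r e = v := by
        intro e he
        rcases Finset.mem_insert.1 he with rfl | he
        · rfl
        · exact (Finset.mem_filter.1 he).2
      exact K.key_inj_r ((a e he).trans (a f hf).symm) (neg_injective hk))
    have hL := alt_sum K.key (H.filter (fun f => K.l f = v)) (by
      intro e he f hf hk
      exact K.key_inj_l ((Finset.mem_filter.1 he).2.trans (Finset.mem_filter.1 hf).2.symm) hk)
    have s1 : ∑ e, K.B (h, true) (e, false) * (if e ∈ H then chi (K.N H (e, false)) else 0) =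
      chi (K.C H v) * ∑ e ∈ H.filter (fun f => K.r f = v), (if e = h then 0 else
        (if - K.key h < - K.key e then 1 else -1) *
        chi (∑ f ∈ H.filter (fun f => K.r f = v), ind (- K.key f < - K.key e))) := by
      rw [Finset.mul_sum, Finset.sum_filter, ← Finset.sum_filter_add_sum_filter_not Finset.univ (· ∈ H)]
      rw [Finset.sum_eq_zero (s := Finset.univ.filter (fun e => ¬ e ∈ H)), add_zero]
      · rw [Finset.filter_mem_eq_inter, Finset.univ_inter]
        refine Finset.sum_congr rfl fun e he => ?_
        by_cases hle : K.r e = v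
        · by_cases heh : e = h
          · simp [B, heh]
          · have : h ≠ e := Ne.symm heh
            simp only [B, tgt, src, if_pos he, N_false, chi_add, hle, heh, this, ← hv,
              K.key_r h e (hv ▸ hle.symm)]
            simp [this]
        · have : v ≠ K.r e := Ne.symm hle
          simp [B, tgt, src, hle, ← hv, this]
      · intro e he
        simp [(Finset.mem_filter.1 he).2]
    have s2 : ∑ e, K.B (h, true) (e, true) * (if e ∈ H then chi (K.N H (e, true)) else 0) =
      chi (K.C H v) * ∑ e ∈ H.filter (fun f => K.l f = v), 
        chi (∑ f ∈ H.filter (fun f => K.l f = v), ind (K.key f < K.key e)) := by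
      rw [Finset.mul_sum, Finset.sum_filter, ← Finset.sum_filter_add_sum_filter_not Finset.univ (· ∈ H)]
      rw [Finset.sum_eq_zero (s := Finset.univ.filter (fun e => ¬ e ∈ H)), add_zero]
      · rw [Finset.filter_mem_eq_inter, Finset.univ_inter]
        refine Finset.sum_congr rfl fun e he => ?_
        by_cases hle : K.l e = v
        · have : h ≠ e := by
            rintro rfl
            have := K.hlr h
            rw [hle] at this
            exact lt_irrefl _ this
          simp only [B, tgt, src, if_pos he, N_true, chi_add, hle, this, ← hv]
          simp [this]
        · have : v ≠ K.l e := Ne.symm hle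
          simp [B, tgt, src, hle, ← hv, this]
      · intro e he
        simp [(Finset.mem_filter.1 he).2]
    rw [s1, s2, hR, hL]
    simp only [rev, Bool.not_true, N_false, chi_add, ← hv, Finset.mem_filter]
    rcases e1 ((H.filter (fun f => K.l f = v)).card : ZMod 2) with a | a <;>
    rcases e1 ((H.filter (fun f => K.r f = v)).card : ZMod 2) with b | b <;>
    rw [a, b] at hodd ⊢ <;> simp [e2] at hodd ⊢ <;> by_cases hh : h ∈ H <;> simp [hh, hv] <;> try ring

end SweepData
end KWabstract

section KWabstract2
set_option linter.unusedSectionVars false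
set_option linter.unusedSimpArgs false
set_option linter.unnecessarySeqFocus false
open scoped Classical
namespace SweepData
variable {U E : Type*} [Fintype U] [DecidableEq U] [Fintype E] [DecidableEq E]
variable (K : SweepData U E)

def Fh (e0 : E) (F : Finset E) (v : U) : Finset E := if v = K.l e0 then insert e0 F else F

def sg (e0 : E) (F : Finset E) (d : E × Bool) : ZMod 2 :=
  K.N (K.Fh e0 F (K.src d)) d + (K.N F (e0, true) + ind (K.x (K.l e0) < K.x (K.src d)))

def ok (e0 : E) (F : Finset E) (v : U) : Prop :=
  e0 ∉ F ∧ ∀ u, K.bd F u = ind (u = v) + ind (u = K.l e0)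

def wt (w : E → ℝ) (F : Finset E) : ℝ := ∏ f ∈ F, w f

/-- numerator of the fermionic observable -/
def Nn (e0 : E) (w : E → ℝ) (d : E × Bool) : ℝ := ∑ F : Finset E,
  if K.ok e0 F (K.tgt d) ∧ d.1 ∉ K.Fh e0 F (K.tgt d) then chi (K.sg e0 F (rev d)) * wt w F else 0

def Yn (e0 : E) (w : E → ℝ) (d : E × Bool) : ℝ := ∑ F : Finset E,
  if K.ok e0 F (K.src d) ∧ d.1 ∈ K.Fh e0 F (K.src d) then chi (K.sg e0 F d) * wt w F else 0

def even (F : Finset E) : Prop := ∀ u, K.bd F u = 0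

def Zev (w : E → ℝ) : ℝ := ∑ F : Finset E, if K.even F then wt w F else 0
def Rr (e : E) (w : E → ℝ) : ℝ := ∑ F : Finset E, if e ∉ F ∧ K.even F then wt w F else 0
def Qq (e : E) (w : E → ℝ) : ℝ := ∑ F : Finset E, if e ∉ F ∧ K.even (insert e F) then wt w F else 0

lemma sum_insert_shift (e : E) (g : Finset E → ℝ) :
    ∑ F : Finset E, (if e ∈ F then g F else 0) =
    ∑ F : Finset E, (if e ∉ F then g (insert e F) else 0) := by
  rw [← Finset.sum_filter, ← Finset.sum_filter]
  refine Finset.sum_bij' (fun F _ => F.erase e) (fun F _ => insert e F) ?_ ?_ ?_ ?_ ?_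
  · intro F hF; simp
  · intro F hF; simp
  · intro F hF; exact Finset.insert_erase (by simpa using hF)
  · intro F hF; exact Finset.erase_insert (by simpa using hF)
  · intro F hF; rw [Finset.insert_erase (by simpa using hF)]

lemma bd_insert {e : E} {F : Finset E} (h : e ∉ F) (u : U) : K.bd (insert e F) u =
    ind (K.l e = u) + ind (K.r e = u) + K.bd F u := by
  unfold bd; rw [Finset.sum_insert h]

lemma N_insert {e : E} {F : Finset E} (h : e ∉ F) (d : E × Bool) : K.N (insert e F) d =
    K.nb e d + K.N F d := by
  unfold N; rw [Finset.sum_insert h]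

lemma wt_insert {e : E} {F : Finset E} (h : e ∉ F) (w : E → ℝ) : wt w (insert e F) =
    w e * wt w F := by
  unfold wt; rw [Finset.prod_insert h]

lemma Zev_eq (e : E) (w : E → ℝ) : K.Zev w = K.Rr e w + w e * K.Qq e w := by
  have h1 : K.Zev w = K.Rr e w + ∑ F : Finset E, (if e ∈ F then (if K.even F then wt w F else 0) else 0) := by
    unfold Zev Rr
    rw [← Finset.sum_add_distrib]
    refine Finset.sum_congr rfl fun F _ => ?_
    by_cases h : e ∈ F <;> simp [h]
  rw [h1, sum_insert_shift]
  congr 1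
  unfold Qq
  rw [Finset.mul_sum]
  refine Finset.sum_congr rfl fun F _ => ?_
  by_cases h : e ∈ F
  · simp [h]
  · by_cases h' : K.even (insert e F) <;> simp [h, h', wt_insert]

lemma z2 (a : ZMod 2) : a + a = 0 := by revert a; decide

lemma ind_comm (a b : U) : ind (a = b) = ind (b = a) :=
  congrArg ind (propext eq_comm)

lemma local_rel (e0 : E) (w : E → ℝ) (d : E × Bool) :
    K.Nn e0 w d = ∑ d', K.B d d' * K.Yn e0 w d' := by
  unfold Nn Yn
  simp_rw [Finset.mul_sum]
  rw [Finset.sum_comm]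
  refine Finset.sum_congr rfl fun F _ => ?_
  by_cases hok : K.ok e0 F (K.tgt d)
  · set H := K.Fh e0 F (K.tgt d) with hH
    have hodd : K.bd H (K.tgt d) = 1 := by
      rw [hH]
      unfold Fh
      split_ifs with h
      · have hr : K.r e0 ≠ K.l e0 := fun h' => by
          have := K.hlr e0; rw [h'] at this; exact lt_irrefl _ this
        rw [bd_insert K hok.1, hok.2, h]
        simp [ind_neg hr, z2]
      · rw [hok.2]; simp [ind_neg h]
    have key := K.local_id H d hodd
    set c := chi (K.N F (e0, true) + ind (K.x (K.l e0) < K.x (K.tgt d))) * wt w F with hc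
    have e1 : ∀ d', K.B d d' * (if K.ok e0 F (K.src d') ∧ d'.1 ∈ K.Fh e0 F (K.src d') then
        chi (K.sg e0 F d') * wt w F else 0) =
        K.B d d' * (if d'.1 ∈ H then chi (K.N H d') else 0) * c := by
      intro d'
      by_cases hB : K.tgt d = K.src d'
      · rw [← hB]
        simp only [hok, true_and, ← hH]
        by_cases hd : d'.1 ∈ H
        · simp only [hd, if_true, sg, chi_add, hc, ← hB, ← hH]; ring
        · simp [hd]
      · have : K.B d d' = 0 := by simp [B, hB]
        simp [this]
    simp_rw [e1]
    rw [← Finset.sum_mul, key]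
    have hsr : K.src (rev d) = K.tgt d := by
      rcases d with ⟨h, _ | _⟩ <;> simp [src, tgt, rev]
    by_cases hd : d.1 ∈ H
    · simp [hd]
    · simp only [hok, hd, sg, chi_add, hc, hsr, ← hH]; simp; ring
  · simp only [hok, false_and, if_false]
    symm
    refine Finset.sum_eq_zero fun d' _ => ?_
    by_cases hB : K.tgt d = K.src d'
    · rw [← hB]; simp [hok]
    · have : K.B d d' = 0 := by simp [B, hB]
      simp [this]

lemma not_VBP_l (e : E) : ¬ K.VBP (K.l e) e := fun h => lt_irrefl _ h.1
lemma not_VBP_r (e : E) : ¬ K.VBP (K.r e) e := fun h => lt_irrefl _ h.2.1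

lemma prop_key (e e0 : E) (hne : e ≠ e0) :
    ind (K.VBP (K.l e0) e) + (if K.l e = K.l e0 then K.nb e0 (e, true) else 0) +
    (if K.r e = K.l e0 then K.nb e0 (e, false) else 0) + K.nb e (e0, true) +
    ind (K.x (K.l e0) < K.x (K.l e)) + ind (K.x (K.l e0) < K.x (K.r e)) = 0 := by
  have hlr := K.hlr e
  have hlr0 := K.hlr e0
  have e2 : (1 : ZMod 2) + 1 = 0 := by decide
  by_cases hl : K.l e = K.l e0
  · have h1 : ¬ K.VBP (K.l e0) e := by rw [← hl]; exact K.not_VBP_l e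
    have h2 : K.r e ≠ K.l e0 := by rintro h; rw [h, hl] at hlr; exact lt_irrefl _ hlr
    have h3 := K.bel_tot e e0 hne (by rw [hl]; exact hlr0) (by rw [← hl]; exact hlr)
    rw [hl] at hlr
    by_cases hb : K.Bel e0 e
    · have : ¬ K.Bel e e0 := fun h => h3.1 h hb
      simp [ind_neg h1, hl, h2, nb, hb, this, hlr, e2]
    · have := h3.2 hb
      simp [ind_neg h1, hl, h2, nb, hb, this, hlr, e2]
  by_cases hr : K.r e = K.l e0
  · have h1 : ¬ K.VBP (K.l e0) e := by rw [← hr]; exact K.not_VBP_r e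
    have h3 : ¬ K.Bel e0 e := fun h => by
      have := (K.bel_ov _ _ h).1; rw [hr] at this; exact lt_irrefl _ this
    have h4 : ¬ K.Bel e e0 := fun h => by
      have := (K.bel_ov _ _ h).2; rw [hr] at this; exact lt_irrefl _ this
    rw [hr] at hlr
    simp [ind_neg h1, hl, hr, nb, h3, h4, not_lt.2 hlr.le]
  have hxl : K.x (K.l e) ≠ K.x (K.l e0) := fun h => hl (K.hx h)
  have hxr : K.x (K.r e) ≠ K.x (K.l e0) := fun h => hr (K.hx h)
  rcases lt_or_gt_of_ne hxl with a | a
  · rcases lt_or_gt_of_ne hxr with b | b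
    · have h1 : ¬ K.VBP (K.l e0) e := fun h => by linarith [h.2.1]
      have h4 : ¬ K.Bel e e0 := fun h => by linarith [(K.bel_ov _ _ h).2]
      simp [ind_neg h1, hl, hr, nb, h4, not_lt.2 a.le, not_lt.2 b.le]
    · have h1 := K.not_bel_iff e e0 (K.l e0) (Or.inl rfl) a b
      by_cases hb : K.VBP (K.l e0) e
      · have : ¬ K.Bel e e0 := fun h => h1.1 h hb
        simp [hl, hr, nb, this, hb, not_lt.2 a.le, b, e2]
      · have := h1.2 hb
        simp [hl, hr, nb, this, hb, not_lt.2 a.le, a.le, b, e2]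
  · have h1 : ¬ K.VBP (K.l e0) e := fun h => by linarith [h.1]
    have b : K.x (K.l e0) < K.x (K.r e) := by linarith
    simp [ind_neg h1, hl, hr, nb, not_le.2 a, a, b, e2]

lemma N_Fh {e0 : E} {F : Finset E} (h : e0 ∉ F) (v : U) (d : E × Bool) :
    K.N (K.Fh e0 F v) d = (if v = K.l e0 then K.nb e0 d else 0) + K.N F d := by
  unfold Fh
  split_ifs
  · rw [N_insert K h]
  · simp

lemma nb_self (e : E) (s : Bool) : K.nb e (e, s) = 0 := by
  simp [nb, K.bel_irrefl]

lemma sg_insert (e0 e : E) (F : Finset E) (s : Bool) (hne : e ≠ e0) (heF : e ∉ F)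
    (hok : K.ok e0 F (K.tgt (e, s))) : K.sg e0 (insert e F) (e, s) = K.sg e0 F (rev (e, s)) := by
  have h0 : e0 ∉ insert e F := by
    rw [Finset.mem_insert]; rintro (h | h)
    · exact hne h.symm
    · exact hok.1 h
  have pk := K.prop_key e e0 hne
  have hN := K.N_add' F e _ _ hok.2
  have hN2 : ind (K.VBP (K.tgt (e, s)) e) = 0 := by
    cases s <;> simp [tgt, K.not_VBP_l, K.not_VBP_r]
  rw [hN2, zero_add] at hN
  rw [← hN] at pk
  unfold sg
  rw [N_Fh K h0, N_Fh K hok.1, N_insert K heF, N_insert K heF, nb_self, zero_add]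
  generalize hA : K.N F (e, true) = A at *
  generalize hB : K.N F (e, false) = B at *
  generalize hC : K.N F (e0, true) = C at *
  cases s
  all_goals
    simp only [src, rev, Bool.not_false, Bool.not_true, if_true, Bool.false_eq_true, if_false, hA, hB]
    generalize (if K.l e = K.l e0 then K.nb e0 (e, true) else 0) = a1 at *
    generalize (if K.r e = K.l e0 then K.nb e0 (e, false) else 0) = a2 at *
    generalize K.nb e (e0, true) = a3 at *
    generalize ind (K.x (K.l e0) < K.x (K.l e)) = a4 at *
    generalize ind (K.x (K.l e0) < K.x (K.r e)) = a5 at *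
    clear hA hB hC hN hN2 h0 hok
    have h2 : (2 : ZMod 2) = 0 := by decide
  · linear_combination pk - (A + a1 + a4) * h2 
  · linear_combination pk - (B + a2 + a5) * h2

lemma ok_insert (e0 e : E) (F : Finset E) (s : Bool) (hne : e ≠ e0) (heF : e ∉ F) :
    K.ok e0 (insert e F) (K.src (e, s)) ↔ K.ok e0 F (K.tgt (e, s)) := by
  unfold ok
  have h0 : e0 ∉ insert e F ↔ e0 ∉ F := by
    rw [Finset.mem_insert, not_or]; exact ⟨fun h => h.2, fun h => ⟨hne.symm, h⟩⟩
  rw [h0]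
  refine and_congr_right fun _ => forall_congr' fun u => ?_
  rw [bd_insert K heF]
  have h2 : (2 : ZMod 2) = 0 := by decide
  cases s
  · simp only [src, tgt, if_true, Bool.false_eq_true, if_false, ind_comm u (K.r e), ind_comm u (K.l e)]
    constructor
    · intro h; linear_combination h - ind (K.l e = u) * h2
    · intro h; linear_combination h + ind (K.l e = u) * h2
  · simp only [src, tgt, if_true, Bool.false_eq_true, if_false, ind_comm u (K.r e), ind_comm u (K.l e)]
    constructor
    · intro h; linear_combination h - ind (K.r e = u) * h2
    · intro h; linear_combination h + ind (K.r e = u) * h2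

lemma mem_Fh {e0 e : E} (hne : e ≠ e0) (F : Finset E) (v : U) : e ∈ K.Fh e0 F v ↔ e ∈ F := by
  unfold Fh; split_ifs <;> simp [hne]

lemma even_insert_iff (e0 : E) (F : Finset E) (h : e0 ∉ F) : K.even (insert e0 F) ↔
    ∀ u, K.bd F u = ind (u = K.r e0) + ind (u = K.l e0) := by
  unfold even
  refine forall_congr' fun u => ?_
  rw [bd_insert K h, ind_comm u, ind_comm u]
  have h2 : (2 : ZMod 2) = 0 := by decide
  constructor
  · intro h; linear_combination h - (ind (K.l e0 = u) + ind (K.r e0 = u)) * h2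
  · intro h; linear_combination h + (ind (K.l e0 = u) + ind (K.r e0 = u)) * h2

lemma rl_ne (e : E) : K.r e ≠ K.l e := fun h => by
  have := K.hlr e; rw [h] at this; exact lt_irrefl _ this

lemma Nn_self (e0 : E) (w : E → ℝ) : K.Nn e0 w (e0, true) = - K.Qq e0 w := by
  unfold Nn Qq
  rw [← Finset.sum_neg_distrib]
  refine Finset.sum_congr rfl fun F _ => ?_
  have hF : K.Fh e0 F (K.r e0) = F := by simp [Fh, K.rl_ne]
  simp only [tgt, if_true, hF]
  by_cases h : e0 ∈ F
  · simp [h]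
  · simp only [ok, h, not_false_eq_true, true_and, and_true, K.even_insert_iff e0 F h]
    split_ifs with hb
    · have hN := K.N_add' F e0 _ _ hb
      simp only [K.not_VBP_l, K.not_VBP_r, ind_false, add_zero] at hN
      have : K.sg e0 F (rev (e0, true)) = 1 := by
        simp only [sg, rev, src, Bool.not_true, Bool.false_eq_true, if_false, hF, ind_pos (K.hlr e0)]
        linear_combination hN
      rw [this]; simp
    · simp

lemma Yn_self (e0 : E) (w : E → ℝ) : K.Yn e0 w (e0, true) = K.Rr e0 w := by
  unfold Yn Rr
  refine Finset.sum_congr rfl fun F _ => ?_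
  have hF : K.Fh e0 F (K.l e0) = insert e0 F := by simp [Fh]
  simp only [src, if_true, hF]
  by_cases h : e0 ∈ F
  · simp [h, ok]
  · simp only [ok, h, not_false_eq_true, true_and, z2, even, Finset.mem_insert_self, and_true]
    split_ifs with hb
    · have : K.sg e0 F (e0, true) = 0 := by
        simp only [sg, src, if_true, hF, lt_irrefl, ind_false, add_zero, N_insert K h, nb_self, zero_add, z2]
      rw [this]; simp
    · rfl

lemma prop_rel (e0 : E) (w : E → ℝ) (d : E × Bool) :
    K.Yn e0 w d = (if d = (e0, true) then K.Zev w else 0) + w d.1 * K.Nn e0 w d := by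
  obtain ⟨e, s⟩ := d
  by_cases hne : e = e0
  · subst hne
    cases s
    · have h1 : K.Yn e w (e, false) = 0 := by
        unfold Yn
        refine Finset.sum_eq_zero fun F _ => if_neg ?_
        rintro ⟨a, b⟩
        have hF : K.Fh e F (K.r e) = F := by simp [Fh, K.rl_ne]
        simp only [src, Bool.false_eq_true, if_false, hF] at b
        exact a.1 b
      have h2 : K.Nn e w (e, false) = 0 := by
        unfold Nn
        refine Finset.sum_eq_zero fun F _ => if_neg ?_
        rintro ⟨a, b⟩
        simp [tgt, Fh] at b
      simp [h1, h2]
    · rw [Yn_self, Nn_self, K.Zev_eq e]; simp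
  · have : (e, s) ≠ (e0, true) := fun h => hne (Prod.ext_iff.1 h).1
    rw [if_neg this, zero_add]
    unfold Yn Nn
    simp only [mem_Fh K hne]
    have e1 : ∀ F : Finset E, (if K.ok e0 F (K.src (e, s)) ∧ e ∈ F then
        chi (K.sg e0 F (e, s)) * wt w F else 0) = if e ∈ F then (if K.ok e0 F (K.src (e, s)) then
        chi (K.sg e0 F (e, s)) * wt w F else 0) else 0 := by
      intro F; by_cases h : e ∈ F <;> simp [h]
    simp_rw [e1]
    rw [sum_insert_shift, Finset.mul_sum]
    refine Finset.sum_congr rfl fun F _ => ?_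
    by_cases h : e ∈ F
    · simp [h]
    · simp only [h, not_false_eq_true, if_true, and_true, K.ok_insert e0 e F s hne h]
      split_ifs with hok
      · rw [K.sg_insert e0 e F s hne h hok, wt_insert h]; ring
      · simp

lemma Nn_cont (e0 : E) (d : E × Bool) : Continuous (fun w => K.Nn e0 w d) := by
  unfold Nn wt
  refine continuous_finsetSum _ fun F _ => ?_
  split_ifs <;> fun_prop

lemma mirror_B (d d' : E × Bool) : K.mirror.B d d' = K.B (rev d) (rev d') := by
  obtain ⟨e, s⟩ := d
  obtain ⟨e', s'⟩ := d'
  cases s <;> cases s' <;> simp [B, rev, tgt, src, mirror] <;> rfl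

lemma mirror_bd (F : Finset E) (u : U) : K.mirror.bd F u = K.bd F u := by
  unfold bd
  refine Finset.sum_congr rfl fun f _ => ?_
  simp [mirror, add_comm]

lemma mirror_even : K.mirror.even = K.even := by
  funext F; simp only [even, mirror_bd]

lemma mirror_Zev (w : E → ℝ) : K.mirror.Zev w = K.Zev w := by
  unfold Zev; rw [mirror_even]

lemma mirror_Qq (e : E) (w : E → ℝ) : K.mirror.Qq e w = K.Qq e w := by
  unfold Qq; rw [mirror_even]

theorem exists_observable (d0 : E × Bool) : ∃ M : (E → ℝ) → E × Bool → ℝ,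
    (∀ d, Continuous (fun w => M w d)) ∧
    (∀ w d, M w d = ∑ d', K.B d d' * ((if d' = d0 then K.Zev w else 0) + w d'.1 * M w d')) ∧
    ∀ w, M w d0 = - K.Qq d0.1 w := by
  obtain ⟨e0, s⟩ := d0
  cases s
  · refine ⟨fun w d => K.mirror.Nn e0 w (rev d), fun d => K.mirror.Nn_cont e0 _, ?_, ?_⟩
    · intro w d
      have := K.mirror.local_rel e0 w (rev d)
      simp_rw [prop_rel, mirror_B, mirror_Zev] at this
      dsimp only
      rw [this]
      have hrr : ∀ d : E × Bool, rev (rev d) = d := fun d => by simp [rev]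
      refine Fintype.sum_equiv (Function.Involutive.toPerm rev hrr) _ _ fun d' => ?_
      change _ = K.B d (rev d') * ((if rev d' = (e0, false) then K.Zev w else 0) +
        w d'.1 * K.mirror.Nn e0 w (rev (rev d')))
      rw [hrr, hrr]
      have : (d' = (e0, true)) ↔ (rev d' = (e0, false)) := by
        obtain ⟨e, s⟩ := d'
        cases s <;> simp [rev]
      simp only [this]
    · intro w
      have := K.mirror.Nn_self e0 w
      rw [mirror_Qq] at this
      exact this
  · refine ⟨K.Nn e0, K.Nn_cont e0, ?_, K.Nn_self e0⟩
    intro w d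
    rw [local_rel]
    simp_rw [prop_rel]

end SweepData
end KWabstract2

section KWgeom
set_option linter.unusedSectionVars false
set_option linter.unusedSimpArgs false

variable {V : Type*} [Fintype V] [DecidableEq V]

namespace KWgeom
open SweepData

/-- Rightward oriented edges. -/
abbrev REdge (G : SimpleGraph V) (v : V → ℂ) : Type _ :=
  {p : V × V // G.Adj p.1 p.2 ∧ (v p.1).re < (v p.2).re}

variable {G : SimpleGraph V} {v : V → ℂ}

def slope (e : REdge G v) : ℝ :=
  ((v e.1.2).im - (v e.1.1).im) / ((v e.1.2).re - (v e.1.1).re)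

def ht (e : REdge G v) (t : ℝ) : ℝ := (v e.1.1).im + slope e * (t - (v e.1.1).re)

lemma ht_r (e : REdge G v) (t : ℝ) : ht e t = (v e.1.2).im + slope e * (t - (v e.1.2).re) := by
  have h : (v e.1.2).re - (v e.1.1).re ≠ 0 := (sub_pos.2 e.2.2).ne'
  have : slope e * ((v e.1.2).re - (v e.1.1).re) = (v e.1.2).im - (v e.1.1).im := by
    unfold slope; field_simp
  unfold ht; linarith

lemma ht_mem (e : REdge G v) (t : ℝ) (h1 : (v e.1.1).re ≤ t) (h2 : t ≤ (v e.1.2).re) :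
    (⟨t, ht e t⟩ : ℂ) ∈ segment ℝ (v e.1.1) (v e.1.2) := by
  have hpos : 0 < (v e.1.2).re - (v e.1.1).re := sub_pos.2 e.2.2
  set b := (t - (v e.1.1).re) / ((v e.1.2).re - (v e.1.1).re) with hb
  have hb1 : b * ((v e.1.2).re - (v e.1.1).re) = t - (v e.1.1).re := by
    rw [hb]; field_simp
  have hs : slope e * (t - (v e.1.1).re) = b * ((v e.1.2).im - (v e.1.1).im) := by
    rw [hb]; unfold slope; ring
  refine ⟨1 - b, b, ?_, ?_, by ring, ?_⟩
  · rw [sub_nonneg, hb, div_le_one hpos]; linarith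
  · exact div_nonneg (by linarith) hpos.le
  · apply Complex.ext
    · simp; linarith
    · simp [ht]; linarith

def Bl (f e : REdge G v) : Prop := ∃ t, (v f.1.1).re < t ∧ (v e.1.1).re < t ∧ t < (v f.1.2).re ∧
  t < (v e.1.2).re ∧ ht f t < ht e t

def NoCross (G : SimpleGraph V) (v : V → ℂ) : Prop :=
  ∀ i j k l : V, G.Adj i j → G.Adj k l → s(i, j) ≠ s(k, l) →
      segment ℝ (v i) (v j) ∩ segment ℝ (v k) (v l) ⊆ ({v i, v j} : Set ℂ) ∩ {v k, v l}

lemma sym_ne {e f : REdge G v} (h : e ≠ f) : s(e.1.1, e.1.2) ≠ s(f.1.1, f.1.2) := by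
  intro h'
  rw [Sym2.eq_iff] at h'
  rcases h' with ⟨a, b⟩ | ⟨a, b⟩
  · exact h (Subtype.ext (Prod.ext a b))
  · have h1 := e.2.2
    have h2 := f.2.2
    rw [a, b] at h1
    linarith

lemma nocross (hc : NoCross G v) {e f : REdge G v} (h : e ≠ f) {t : ℝ}
    (h1 : (v e.1.1).re ≤ t) (h2 : t ≤ (v e.1.2).re) (h3 : (v f.1.1).re ≤ t) (h4 : t ≤ (v f.1.2).re)
    (h5 : ht e t = ht f t) : t = (v f.1.1).re ∨ t = (v f.1.2).re := by
  have m1 := ht_mem e t h1 h2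
  have m2 := ht_mem f t h3 h4
  rw [← h5] at m2
  have := (hc _ _ _ _ e.2.1 f.2.1 (sym_ne h) ⟨m1, m2⟩).2
  rcases this with h | h
  · left; exact congrArg Complex.re h
  · right; exact congrArg Complex.re h

lemma ht_cont (e : REdge G v) : Continuous (ht e) := by unfold ht; fun_prop

lemma sign_const (hc : NoCross G v) {f e : REdge G v} (h : f ≠ e) {t1 t2 : ℝ}
    (a1 : (v f.1.1).re ≤ t1) (a2 : t1 ≤ (v f.1.2).re) (a3 : (v e.1.1).re < t1) (a4 : t1 < (v e.1.2).re)
    (b1 : (v f.1.1).re ≤ t2) (b2 : t2 ≤ (v f.1.2).re) (b3 : (v e.1.1).re < t2) (b4 : t2 < (v e.1.2).re)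
    (hlt : ht f t1 < ht e t1) : ht f t2 < ht e t2 := by
  by_contra hcon
  rw [not_lt] at hcon
  have := intermediate_value_uIcc (a := t1) (b := t2) (f := fun t => ht f t - ht e t)
    ((ht_cont f).sub (ht_cont e)).continuousOn
  obtain ⟨t, ht1, ht2⟩ := this (show (0 : ℝ) ∈ _ by
    rw [Set.mem_uIcc]; left; constructor <;> linarith)
  dsimp only at ht2
  rw [Set.mem_uIcc] at ht1
  have hh : (v f.1.1).re ≤ t ∧ t ≤ (v f.1.2).re ∧ (v e.1.1).re < t ∧ t < (v e.1.2).re := by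
    rcases ht1 with ⟨p, q⟩ | ⟨p, q⟩ <;> refine ⟨?_, ?_, ?_, ?_⟩ <;> linarith
  rcases nocross hc h hh.1 hh.2.1 hh.2.2.1.le hh.2.2.2.le (by linarith) with h' | h' <;> linarith

lemma exists_mid (e f : REdge G v) (h1 : (v e.1.1).re < (v f.1.2).re)
    (h2 : (v f.1.1).re < (v e.1.2).re) : ∃ t, (v e.1.1).re < t ∧ (v f.1.1).re < t ∧
      t < (v e.1.2).re ∧ t < (v f.1.2).re := by
  have he := e.2.2
  have hf := f.2.2
  obtain ⟨t, a, b⟩ := exists_between (show max (v e.1.1).re (v f.1.1).re <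
    min (v e.1.2).re (v f.1.2).re by simp [he, hf, h1, h2])
  rw [max_lt_iff] at a
  rw [lt_min_iff] at b
  exact ⟨t, a.1, a.2, b.1, b.2⟩

lemma bl_iff (hc : NoCross G v) {f e : REdge G v} (h : f ≠ e) {t : ℝ}
    (a1 : (v f.1.1).re ≤ t) (a2 : t ≤ (v f.1.2).re) (a3 : (v e.1.1).re < t) (a4 : t < (v e.1.2).re) :
    Bl f e ↔ ht f t < ht e t := by
  constructor
  · rintro ⟨s, h1, h2, h3, h4, h5⟩
    exact sign_const hc h h1.le h3.le h2 h4 a1 a2 a3 a4 h5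
  · intro hlt
    obtain ⟨s, h1, h2, h3, h4⟩ := exists_mid f e (by linarith) (by linarith)
    exact ⟨s, h1, h2, h3, h4, sign_const hc h a1 a2 a3 a4 h1.le h3.le h2 h4 hlt⟩

def sweep (hre : Function.Injective (fun i => (v i).re)) (hc : NoCross G v) :
    SweepData V (REdge G v) where
  l := fun e => e.1.1
  r := fun e => e.1.2
  x := fun i => (v i).re
  hx := hre
  hlr := fun e => e.2.2
  Bel := Bl
  key := slope
  bel_irrefl := by rintro e ⟨t, _, _, _, _, h⟩; exact lt_irrefl _ h
  bel_ov := by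
    rintro e f ⟨t, _, _, _, _, h⟩
    constructor <;> linarith
  bel_tot := by
    intro e f h h1 h2
    obtain ⟨t, a1, a2, a3, a4⟩ := exists_mid e f h1 h2
    rw [bl_iff hc h a1.le a3.le a2 a4, bl_iff hc h.symm a2.le a4.le a1 a3, not_lt]
    constructor
    · exact le_of_lt
    · intro hle
      refine lt_of_le_of_ne hle fun heq => ?_
      rcases nocross hc h a1.le a3.le a2.le a4.le heq with h' | h' <;> linarith
  bel_vert := by
    intro e f g u hf hg h1 h2
    have aux : ∀ f : REdge G v, (u = f.1.1 ∨ u = f.1.2) → (Bl f e ↔ (v u).im < ht e (v u).re) := by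
      intro f hf
      have hne : f ≠ e := by
        rintro rfl
        rcases hf with rfl | rfl
        · exact lt_irrefl _ h1
        · exact lt_irrefl _ h2
      have hlr := f.2.2
      have hht : ht f (v u).re = (v u).im := by
        rcases hf with rfl | rfl
        · simp [ht]
        · simp [ht_r]
      rw [bl_iff hc hne (t := (v u).re) ?_ ?_ h1 h2, hht]
      · rcases hf with rfl | rfl <;> linarith
      · rcases hf with rfl | rfl <;> linarith
    rw [aux f hf, aux g hg]
  key_l := by
    intro e f h
    have hle := e.2.2
    have hlf := f.2.2
    constructor
    · rintro ⟨t, h1, h2, h3, h4, h5⟩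
      simp only [ht] at h5
      rw [← h] at h5
      have : 0 < t - (v e.1.1).re := by linarith
      by_contra hcon
      nlinarith
    · intro hk
      obtain ⟨t, a1, a2, a3, a4⟩ := exists_mid e f (by rw [h]; exact hlf) (by rw [← h]; exact hle)
      refine ⟨t, a1, a2, a3, a4, ?_⟩
      simp only [ht]
      rw [← h]
      have : 0 < t - (v e.1.1).re := by linarith
      nlinarith
  key_r := by
    intro e f h
    have hle := e.2.2
    have hlf := f.2.2
    constructor
    · rintro ⟨t, h1, h2, h3, h4, h5⟩
      simp only [ht_r] at h5
      rw [← h] at h5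
      have : 0 < (v e.1.2).re - t := by linarith
      by_contra hcon
      nlinarith
    · intro hk
      obtain ⟨t, a1, a2, a3, a4⟩ := exists_mid e f (by rw [← h]; exact hle) (by rw [h]; exact hlf)
      refine ⟨t, a1, a2, a3, a4, ?_⟩
      simp only [ht_r]
      rw [← h]
      have : 0 < (v e.1.2).re - t := by linarith
      nlinarith

/-- rightward vector of the edge -/
def uu (e : REdge G v) : ℂ := v e.1.2 - v e.1.1

lemma uu_re (e : REdge G v) : 0 < (uu e).re := by simpa [uu] using e.2.2

lemma arg_ratio {a b : ℂ} (ha : 0 < a.re) (hb : 0 < b.re) : (a / b).arg = a.arg - b.arg := by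
  have h1 := Complex.abs_arg_lt_pi_div_two_iff.2 (Or.inl ha)
  have h2 := Complex.abs_arg_lt_pi_div_two_iff.2 (Or.inl hb)
  rw [abs_lt] at h1 h2
  have hb0 : b ≠ 0 := by rintro rfl; simp at hb
  have ha0 : a ≠ 0 := by rintro rfl; simp at ha
  have hinv : (b⁻¹).arg = - b.arg := by
    rw [Complex.arg_inv, if_neg]; intro h; linarith [Real.pi_pos]
  rw [div_eq_mul_inv, Complex.arg_mul ha0 (inv_ne_zero hb0), hinv]
  · ring
  · rw [hinv]; constructor <;> linarith

lemma im_ratio (e f : REdge G v) : (0 < (uu f / uu e).im ↔ slope e < slope f) ∧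
    ((uu f / uu e).im < 0 ↔ slope f < slope e) := by
  have he := uu_re e
  have hf := uu_re f
  have hs : ∀ e : REdge G v, slope e = (uu e).im / (uu e).re := by
    intro e; simp [slope, uu]
  have hn : 0 < Complex.normSq (uu e) := by
    rw [Complex.normSq_pos]; intro h; rw [h] at he; simp at he
  have : (uu f / uu e).im = ((uu f).im * (uu e).re - (uu f).re * (uu e).im) / Complex.normSq (uu e) := by
    rw [Complex.div_im]; ring
  rw [this, hs, hs, div_lt_div_iff₀ he hf, div_lt_div_iff₀ hf he]
  constructor
  · rw [div_pos_iff_of_pos_right hn]; constructor <;> intro h <;> linarith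
  · rw [div_lt_iff₀ hn, zero_mul]; constructor <;> intro h <;> linarith

def hexp (z : ℂ) : ℂ := Complex.exp (Complex.I / 2 * (z.arg : ℂ))

lemma hexp_ratio {a b : ℂ} (ha : 0 < a.re) (hb : 0 < b.re) :
    hexp (a / b) = (hexp b)⁻¹ * hexp a := by
  unfold hexp
  rw [arg_ratio ha hb, ← Complex.exp_neg, ← Complex.exp_add]
  congr 1; push_cast; ring

lemma hexp_neg_pos {z : ℂ} (h : 0 < z.im) : hexp (-z) = - Complex.I * hexp z := by
  unfold hexp
  rw [Complex.arg_neg_eq_arg_sub_pi_of_im_pos h]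
  have : Complex.I / 2 * ((z.arg - Real.pi : ℝ) : ℂ) =
    -(Real.pi / 2 * Complex.I) + Complex.I / 2 * (z.arg : ℂ) := by push_cast; ring
  rw [this, Complex.exp_add, Complex.exp_neg, Complex.exp_pi_div_two_mul_I]
  simp

lemma hexp_neg_neg {z : ℂ} (h : z.im < 0) : hexp (-z) = Complex.I * hexp z := by
  unfold hexp
  rw [Complex.arg_neg_eq_arg_add_pi_of_im_neg h]
  have : Complex.I / 2 * ((z.arg + Real.pi : ℝ) : ℂ) =
    (Real.pi / 2 * Complex.I) + Complex.I / 2 * (z.arg : ℂ) := by push_cast; ring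
  rw [this, Complex.exp_add, Complex.exp_pi_div_two_mul_I]

/-- gauge -/
def gg (d : REdge G v × Bool) : ℂ := if d.2 then hexp (uu d.1) else Complex.I * hexp (uu d.1)

lemma hexp_ne (z : ℂ) : hexp z ≠ 0 := Complex.exp_ne_zero _

lemma gg_ne (d : REdge G v × Bool) : gg d ≠ 0 := by
  unfold gg; split_ifs <;> simp [hexp_ne]

/-- directed edges -/
def toD (d : REdge G v × Bool) : {p : V × V // G.Adj p.1 p.2} :=
  if d.2 then ⟨d.1.1, d.1.2.1⟩ else ⟨(d.1.1.2, d.1.1.1), d.1.2.1.symm⟩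

lemma gauge (hre : Function.Injective (fun i => (v i).re)) (hc : NoCross G v)
    (d d' : REdge G v × Bool) :
    (if (toD d).1.2 = (toD d').1.1 ∧ (toD d).1.1 ≠ (toD d').1.2 then
      hexp ((v (toD d').1.2 - v (toD d).1.2) / (v (toD d).1.2 - v (toD d).1.1)) else 0) =
    (gg d)⁻¹ * gg d' * ((sweep hre hc).B d d' : ℂ) := by
  haveI : Fintype (REdge G v) := Fintype.ofFinite _
  obtain ⟨e, s⟩ := d
  obtain ⟨f, s'⟩ := d'
  have he := e.2.2
  have hf := f.2.2
  have hI : Complex.I⁻¹ = - Complex.I := Complex.inv_I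
  cases s <;> cases s'
  · -- left, left
    simp only [toD, gg, Bool.false_eq_true, if_false, SweepData.B, SweepData.tgt, SweepData.src, sweep]
    by_cases h : e.1.1 = f.1.2
    · have h1 : e.1.2 ≠ f.1.1 := by intro h'; rw [h, h'] at he; linarith
      have h2 : e ≠ f := by rintro rfl; rw [h] at he; linarith
      have h3 : (v f.1.1 - v e.1.1) / (v e.1.1 - v e.1.2) = uu f / uu e := by
        rw [h, ← neg_sub (v f.1.2) (v f.1.1), ← neg_sub (v e.1.2) (v f.1.2), neg_div_neg_eq]
        simp [uu, h]
      rw [if_pos ⟨h, h1⟩, if_pos ⟨h, h2⟩, h3, hexp_ratio (uu_re f) (uu_re e), mul_inv]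
      have := hexp_ne (uu e)
      simp; field_simp
      rw [Complex.I_sq]; ring
    · simp [h]
  · -- left, right
    simp only [toD, gg, Bool.false_eq_true, if_false, if_true, SweepData.B, SweepData.tgt, SweepData.src, sweep]
    by_cases h : e.1.1 = f.1.1
    · by_cases h1 : e = f
      · subst h1; simp
      · have h2 : e.1.2 ≠ f.1.2 := fun h' => h1 (Subtype.ext (Prod.ext h h'))
        have h3 : (v f.1.2 - v e.1.1) / (v e.1.1 - v e.1.2) = - (uu f / uu e) := by
          rw [← neg_sub (v e.1.2) (v e.1.1), div_neg]
          simp [uu, h]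
        rw [if_pos ⟨h, h2⟩, if_pos ⟨h, h1⟩, h3]
        have hk := (sweep hre hc).key_l e f h
        simp only [sweep] at hk
        by_cases hb : Bl e f
        · rw [hexp_neg_pos ((im_ratio e f).1.2 (hk.1 hb)), hexp_ratio (uu_re f) (uu_re e), mul_inv, hI]
          simp [hb]; ring
        · have hlt : slope f < slope e := lt_of_le_of_ne (not_lt.1 (fun h => hb (hk.2 h))) 
            (fun h' => h1 ((sweep hre hc).key_inj_l h h'.symm))
          rw [hexp_neg_neg ((im_ratio e f).2.2 hlt), hexp_ratio (uu_re f) (uu_re e), mul_inv, hI]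
          simp [hb]; ring
    · simp [h]
  · -- right, left
    simp only [toD, gg, Bool.false_eq_true, if_false, if_true, SweepData.B, SweepData.tgt, SweepData.src, sweep]
    by_cases h : e.1.2 = f.1.2
    · by_cases h1 : e = f
      · subst h1; simp
      · have h2 : e.1.1 ≠ f.1.1 := fun h' => h1 (Subtype.ext (Prod.ext h' h))
        have h3 : (v f.1.1 - v e.1.2) / (v e.1.2 - v e.1.1) = - (uu f / uu e) := by
          rw [← neg_sub (v e.1.2) (v f.1.1), neg_div]
          simp [uu, h]
        rw [if_pos ⟨h, h2⟩, if_pos ⟨h, h1⟩, h3]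
        have hk := (sweep hre hc).key_r e f h
        simp only [sweep] at hk
        by_cases hb : Bl e f
        · rw [hexp_neg_neg ((im_ratio e f).2.2 (hk.1 hb)), hexp_ratio (uu_re f) (uu_re e)]
          simp [hb]; ring
        · have hlt : slope e < slope f := lt_of_le_of_ne (not_lt.1 (fun h => hb (hk.2 h))) 
            (fun h' => h1 ((sweep hre hc).key_inj_r h h'))
          rw [hexp_neg_pos ((im_ratio e f).1.2 hlt), hexp_ratio (uu_re f) (uu_re e)]
          simp [hb]; ring
    · simp [h]
  · simp only [toD, gg, Bool.false_eq_true, if_false, if_true, SweepData.B, SweepData.tgt, SweepData.src, sweep]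
    by_cases h : e.1.2 = f.1.1
    · have h1 : e.1.1 ≠ f.1.2 := by intro h'; rw [h, h'] at he; linarith
      have h2 : e ≠ f := by rintro rfl; rw [h] at he; linarith
      have h3 : (v f.1.2 - v e.1.2) / (v e.1.2 - v e.1.1) = uu f / uu e := by
        simp [uu, h]
      rw [if_pos ⟨h, h1⟩, if_pos ⟨h, h2⟩, h3, hexp_ratio (uu_re f) (uu_re e)]
      simp
    · simp [h]

end KWgeom
end KWgeom

section KWhight
set_option linter.unusedSectionVars false
set_option linter.unusedSimpArgs false
open scoped Classical
namespace SweepData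
variable {U E : Type*} [Fintype U] [DecidableEq U] [Fintype E] [DecidableEq E]
variable (K : SweepData U E)

/-- sign of a Boolean -/
def sp (b : Bool) : ℝ := if b then 1 else -1

def dg (F : Finset E) (u : U) : ℕ :=
  ∑ f ∈ F, ((if K.l f = u then 1 else 0) + (if K.r f = u then 1 else 0))

lemma bd_eq_dg (F : Finset E) (u : U) : K.bd F u = (K.dg F u : ZMod 2) := by
  unfold bd dg ind; push_cast
  refine Finset.sum_congr rfl fun f _ => ?_
  congr 1 <;> split_ifs <;> rfl

lemma prod_sp (F : Finset E) (x : U → Bool) :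
    ∏ f ∈ F, (sp (x (K.l f)) * sp (x (K.r f))) = ∏ u, sp (x u) ^ K.dg F u := by
  unfold dg
  simp_rw [← Finset.prod_pow_eq_pow_sum]
  rw [Finset.prod_comm]
  refine Finset.prod_congr rfl fun f _ => ?_
  simp_rw [pow_add]
  rw [Finset.prod_mul_distrib]
  simp [pow_ite, Finset.prod_ite_eq]

lemma sum_sp (F : Finset E) :
    ∑ x : U → Bool, ∏ f ∈ F, (sp (x (K.l f)) * sp (x (K.r f))) =
      if K.even F then (2 : ℝ) ^ Fintype.card U else 0 := by
  simp_rw [prod_sp]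
  have h := Finset.prod_univ_sum (fun _ : U => (Finset.univ : Finset Bool))
    (fun u b => sp b ^ K.dg F u)
  rw [Fintype.piFinset_univ] at h
  rw [← h]
  have h2 : ∀ u, ∑ b, sp b ^ K.dg F u = if K.bd F u = 0 then (2 : ℝ) else 0 := by
    intro u
    have hz : K.bd F u = 0 ↔ Even (K.dg F u) := by
      rw [bd_eq_dg, ZMod.natCast_eq_zero_iff_even]
    simp only [hz]
    simp only [Fintype.sum_bool, sp, if_true, one_pow, Bool.false_eq_true, if_false]
    split_ifs with hh
    · rw [hh.neg_one_pow]; norm_num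
    · rw [(Nat.not_even_iff_odd.1 hh).neg_one_pow]; norm_num
  simp_rw [h2]
  by_cases he : K.even F
  · rw [if_pos he, Finset.prod_congr rfl (fun u _ => if_pos (he u))]
    simp
  · rw [if_neg he]
    unfold even at he
    push Not at he
    obtain ⟨u, hu⟩ := he
    exact Finset.prod_eq_zero (Finset.mem_univ u) (if_neg hu)

lemma high_temp (w : E → ℝ) :
    ∑ x : U → Bool, ∏ e, (1 + w e * (sp (x (K.l e)) * sp (x (K.r e)))) =
      2 ^ Fintype.card U * K.Zev w := by
  simp_rw [Finset.prod_one_add]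
  rw [Finset.sum_comm, Finset.powerset_univ]
  unfold Zev
  rw [Finset.mul_sum]
  refine Finset.sum_congr rfl fun F _ => ?_
  simp_rw [Finset.prod_mul_distrib (f := w)]
  rw [← Finset.mul_sum, sum_sp]
  unfold wt
  split_ifs <;> ring

lemma Rr_congr (e : E) {w w' : E → ℝ} (h : ∀ f, f ≠ e → w f = w' f) : K.Rr e w = K.Rr e w' := by
  unfold Rr wt
  refine Finset.sum_congr rfl fun F _ => ?_
  split_ifs with hF
  · exact Finset.prod_congr rfl fun f hf => h f (fun hfe => hF.1 (hfe ▸ hf))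
  · rfl

lemma Qq_congr (e : E) {w w' : E → ℝ} (h : ∀ f, f ≠ e → w f = w' f) : K.Qq e w = K.Qq e w' := by
  unfold Qq wt
  refine Finset.sum_congr rfl fun F _ => ?_
  split_ifs with hF
  · exact Finset.prod_congr rfl fun f hf => h f (fun hfe => hF.1 (hfe ▸ hf))
  · rfl

lemma Zev_cont : Continuous K.Zev := by
  unfold Zev wt
  refine continuous_finsetSum _ fun F _ => ?_
  split_ifs <;> fun_prop

end SweepData

lemma hasDerivAt_mul_vanish {f g : ℝ → ℂ} {t0 : ℝ} {f' : ℂ} (hf : HasDerivAt f f' t0)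
    (hg : ContinuousAt g t0) :
    HasDerivAt (fun t => (f t - f t0) * g t) (f' * g t0) t0 := by
  rw [hasDerivAt_iff_tendsto_slope] at hf ⊢
  have := hf.mul (hg.tendsto.mono_left nhdsWithin_le_nhds)
  refine this.congr fun t => ?_
  simp [slope_def_module, mul_assoc]

/-- Resolvent perturbation. -/
lemma resolvent_deriv {D : Type*} [Fintype D] [DecidableEq D] (A S : Matrix D D ℂ)
    (g : ℝ → D → ℂ) (g' : D → ℂ) (X : ℝ → D → ℂ) (t0 : ℝ) (d0 : D)
    (hdet : IsUnit (1 - A * Matrix.diagonal (g t0)).det)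
    (hS : S = (1 - A * Matrix.diagonal (g t0))⁻¹ * A)
    (hg : ∀ d, HasDerivAt (fun t => g t d) (g' d) t0)
    (hX : ∀ d, ContinuousAt (fun t => X t d) t0)
    (heq : ∀ t d, X t d = ∑ d', A d d' * ((if d' = d0 then 1 else 0) + g t d' * X t d')) (d : D) :
    HasDerivAt (fun t => X t d) (∑ d', S d d' * (g' d' * S d' d0)) t0 := by
  have key : ∀ t, X t = S.mulVec (fun d' => (if d' = d0 then 1 else 0) + (g t d' - g t0 d') * X t d') := by
    intro t
    have h1 : (1 - A * Matrix.diagonal (g t0)).mulVec (X t) =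
        A.mulVec (fun d' => (if d' = d0 then 1 else 0) + (g t d' - g t0 d') * X t d') := by
      rw [Matrix.sub_mulVec, Matrix.one_mulVec, ← Matrix.mulVec_mulVec, sub_eq_iff_eq_add,
        ← Matrix.mulVec_add]
      funext d
      rw [heq t d]
      simp only [Matrix.mulVec, dotProduct, Pi.add_apply]
      refine Finset.sum_congr rfl fun d' _ => ?_
      rw [← dotProduct, ← Matrix.mulVec, Matrix.mulVec_diagonal]
      ring
    rw [hS, ← Matrix.mulVec_mulVec, ← h1, Matrix.mulVec_mulVec, Matrix.nonsing_inv_mul _ hdet,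
      Matrix.one_mulVec]
  have k2 : ∀ t d, X t d = S d d0 + ∑ d', S d d' * ((g t d' - g t0 d') * X t d') := by
    intro t d
    conv_lhs => rw [key t]
    simp [Matrix.mulVec, dotProduct, mul_add, Finset.sum_add_distrib]
  have h0 : ∀ d, X t0 d = S d d0 := by intro d; rw [k2]; simp
  have : (fun t => X t d) = fun t => S d d0 + ∑ d', S d d' * ((g t d' - g t0 d') * X t d') := by
    funext t; exact k2 t d
  rw [this]
  refine HasDerivAt.const_add _ (HasDerivAt.fun_sum fun d' _ => ?_)
  rw [← h0 d']
  exact (hasDerivAt_mul_vanish (hg d') (hX d')).const_mul _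

end KWhight

section KWfinal
set_option linter.unusedSectionVars false
set_option linter.unusedSimpArgs false
open scoped Classical
namespace KWgeom
open SweepData
variable {G : SimpleGraph V} {v : V → ℂ}

lemma toD_inj : Function.Injective (toD : REdge G v × Bool → _) := by
  rintro ⟨e, s⟩ ⟨f, s'⟩ h
  have he := e.2.2
  have hf := f.2.2
  cases s <;> cases s' <;> simp only [toD, Bool.false_eq_true, if_false, if_true, Subtype.mk.injEq] at h
  · have : e = f := Subtype.ext (Prod.ext (congrArg Prod.snd h) (congrArg Prod.fst h))
    rw [this]
  · have h1 := congrArg Prod.fst h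
    have h2 := congrArg Prod.snd h
    simp only at h1 h2
    rw [← h1, ← h2] at hf; linarith
  · have h1 := congrArg Prod.fst h
    have h2 := congrArg Prod.snd h
    simp only at h1 h2
    rw [h1, h2] at he; linarith
  · have : e = f := Subtype.ext h
    rw [this]

lemma toD_surj (hre : Function.Injective (fun i => (v i).re)) :
    Function.Surjective (toD : REdge G v × Bool → _) := by
  rintro ⟨⟨i, j⟩, h⟩
  have hne : (v i).re ≠ (v j).re := fun h' => h.ne (hre h')
  rcases lt_or_gt_of_ne hne with h' | h'
  · exact ⟨(⟨(i, j), h, h'⟩, true), by simp [toD]⟩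
  · exact ⟨(⟨(j, i), h.symm, h'⟩, false), by simp [toD]⟩

/-- Directed edges as rightward edges with a direction. -/
def tau (hre : Function.Injective (fun i => (v i).re)) :
    REdge G v × Bool ≃ {p : V × V // G.Adj p.1 p.2} :=
  Equiv.ofBijective toD ⟨toD_inj, toD_surj hre⟩

/-- underlying unordered edge -/
def ue (e : REdge G v) : Sym2 V := s(e.1.1, e.1.2)

lemma ue_inj : Function.Injective (ue : REdge G v → _) := by
  intro e f h
  by_contra hne
  exact sym_ne hne h

lemma toD_sym (d : REdge G v × Bool) : s((toD d).1.1, (toD d).1.2) = ue d.1 := by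
  unfold toD ue
  split_ifs
  · rfl
  · exact Sym2.eq_swap

lemma exp_spin (θ s : ℝ) (h : s = 1 ∨ s = -1) :
    Real.exp (θ * s) = Real.cosh θ * (1 + Real.tanh θ * s) := by
  have hc := (Real.cosh_pos θ).ne'
  rw [Real.tanh_eq_sinh_div_cosh]
  rcases h with rfl | rfl
  · field_simp
    rw [Real.cosh_add_sinh]
  · field_simp
    rw [← sub_eq_add_neg, Real.cosh_sub_sinh]

lemma partition_eq [DecidableRel G.Adj] (hre : Function.Injective (fun i => (v i).re))
    (hc : NoCross G v) (θ : Sym2 V → ℝ) :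
    partitionFn G (fun _ => 0) θ = (∏ e : REdge G v, Real.cosh (θ (ue e))) *
      (2 ^ Fintype.card V * (sweep hre hc).Zev (fun e => Real.tanh (θ (ue e)))) := by
  rw [← SweepData.high_temp, Finset.mul_sum]
  unfold partitionFn
  refine Finset.sum_congr rfl fun x _ => ?_
  rw [← Finset.prod_mul_distrib]
  have h1 : energy G (fun _ => 0) θ x =
      ∑ e : REdge G v, θ (ue e) * (sp (x e.1.1) * sp (x e.1.2)) := by
    unfold energy
    simp only [zero_mul, Finset.sum_const_zero, zero_add]
    symm
    refine Finset.sum_bij (fun e _ => ue e) ?_ ?_ ?_ ?_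
    · intro e _; simp [ue, e.2.1]
    · intro e _ f _ h; exact ue_inj h
    · intro b hb
      induction b using Sym2.ind with
      | _ i j =>
        have hadj : G.Adj i j := by simpa using hb
        obtain ⟨d, hd⟩ := toD_surj (v := v) hre ⟨(i, j), hadj⟩
        refine ⟨d.1, Finset.mem_univ _, ?_⟩
        rw [← toD_sym, hd]
    · intro e _
      simp [ue, pairProd, sp, spin]
  rw [h1, Real.exp_sum]
  refine Finset.prod_congr rfl fun e _ => ?_
  refine exp_spin _ _ ?_
  simp only [sweep, sp]
  split_ifs <;> simp

lemma partition_pos [DecidableRel G.Adj] (θ : Sym2 V → ℝ) : 0 < partitionFn G (fun _ => 0) θ := by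
  unfold partitionFn
  exact Finset.sum_pos (fun x _ => Real.exp_pos _) Finset.univ_nonempty

lemma Zev_pos [DecidableRel G.Adj] (hre : Function.Injective (fun i => (v i).re))
    (hc : NoCross G v) (θ : Sym2 V → ℝ) :
    0 < (sweep hre hc).Zev (fun e => Real.tanh (θ (ue e))) := by
  have h := partition_pos (G := G) θ
  rw [partition_eq hre hc θ] at h
  have h1 : 0 < ∏ e : REdge G v, Real.cosh (θ (ue e)) :=
    Finset.prod_pos fun e _ => Real.cosh_pos _
  have h2 : (0 : ℝ) < 2 ^ Fintype.card V := by positivity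
  exact (mul_pos_iff_of_pos_left h2).1 ((mul_pos_iff_of_pos_left h1).1 h)

lemma hasDerivAt_tanh (x : ℝ) : HasDerivAt Real.tanh (1 - Real.tanh x ^ 2) x := by
  have hc := (Real.cosh_pos x).ne'
  have h := (Real.hasDerivAt_sinh x).div (Real.hasDerivAt_cosh x) hc
  have h2 : Real.tanh = fun y => Real.sinh y / Real.cosh y := by
    funext y; exact Real.tanh_eq_sinh_div_cosh y
  rw [h2]
  refine h.congr_deriv ?_
  field_simp

/-- The inner derivative. -/
lemma inner_deriv [DecidableRel G.Adj] (hre : Function.Injective (fun i => (v i).re))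
    (hc : NoCross G v) (θ : Sym2 V → ℝ) (e0 : REdge G v) :
    HasDerivAt (fun u => Real.log (partitionFn G (fun _ => 0) (Function.update θ (ue e0) u)))
      (Real.tanh (θ (ue e0)) + (1 - Real.tanh (θ (ue e0)) ^ 2) *
        ((sweep hre hc).Qq e0 (fun e => Real.tanh (θ (ue e))) /
          (sweep hre hc).Zev (fun e => Real.tanh (θ (ue e))))) (θ (ue e0)) := by
  set w : REdge G v → ℝ := fun e => Real.tanh (θ (ue e)) with hw
  set K := sweep hre hc with hK
  have hoff : ∀ u (f : REdge G v), f ≠ e0 → Function.update θ (ue e0) u (ue f) = θ (ue f) := by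
    intro u f hf
    exact Function.update_of_ne (fun h => hf (ue_inj h)) _ _
  set c : ℝ := (∏ e ∈ Finset.univ.erase e0, Real.cosh (θ (ue e))) * 2 ^ Fintype.card V with hcdef
  have hcpos : 0 < c := by
    refine mul_pos (Finset.prod_pos fun e _ => Real.cosh_pos _) (by positivity)
  have hZ : ∀ u, K.Zev (fun e => Real.tanh (Function.update θ (ue e0) u (ue e))) =
      K.Rr e0 w + Real.tanh u * K.Qq e0 w := by
    intro u
    rw [K.Zev_eq e0, K.Rr_congr e0 (w' := w), K.Qq_congr e0 (w' := w), Function.update_self]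
    · intro f hf; simp only [hoff u f hf, hw]
    · intro f hf; simp only [hoff u f hf, hw]
  have hform : (fun u => Real.log (partitionFn G (fun _ => 0) (Function.update θ (ue e0) u))) =
      fun u => Real.log c + Real.log (Real.cosh u) +
        Real.log (K.Rr e0 w + Real.tanh u * K.Qq e0 w) := by
    funext u
    have hp := Zev_pos hre hc (Function.update θ (ue e0) u)
    rw [← hK, hZ] at hp
    rw [partition_eq hre hc, ← hK, hZ, ← Finset.mul_prod_erase _ _ (Finset.mem_univ e0),
      Function.update_self,
      Finset.prod_congr rfl (g := fun e => Real.cosh (θ (ue e)))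
        (fun f hf => by rw [hoff u f (Finset.ne_of_mem_erase hf)]),
      ← Real.log_mul hcpos.ne' (Real.cosh_pos u).ne',
      ← Real.log_mul (mul_pos hcpos (Real.cosh_pos u)).ne' hp.ne', hcdef]
    congr 1; ring
  have hp0 := Zev_pos hre hc θ
  rw [← hK, ← hw] at hp0
  have hz0 : K.Zev w = K.Rr e0 w + Real.tanh (θ (ue e0)) * K.Qq e0 w := K.Zev_eq e0 w
  rw [hform]
  rw [hz0] at hp0 ⊢
  have d1 := (Real.hasDerivAt_cosh (θ (ue e0))).log (Real.cosh_pos _).ne'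
  have d2 := (((hasDerivAt_tanh (θ (ue e0))).mul_const (K.Qq e0 w)).const_add (K.Rr e0 w)).log hp0.ne'
  refine ((d1.const_add (Real.log c)).add d2).congr_deriv ?_
  rw [Real.tanh_eq_sinh_div_cosh]
  ring

end KWgeom
end KWfinal

section KWfinal2
set_option linter.unusedSectionVars false
set_option linter.unusedSimpArgs false
open scoped Classical
namespace KWgeom
open SweepData
variable {G : SimpleGraph V} {v : V → ℂ}

/-- Kac-Ward matrix entries. -/
def KWA (G : SimpleGraph V) (v : V → ℂ) (A : Matrix {p : V × V // G.Adj p.1 p.2}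
    {p : V × V // G.Adj p.1 p.2} ℂ) : Prop :=
  ∀ d d' : {p : V × V // G.Adj p.1 p.2}, A d d' =
      if d.1.2 = d'.1.1 ∧ d.1.1 ≠ d'.1.2 then
        Complex.exp (Complex.I / 2 *
          (Complex.arg ((v d'.1.2 - v d.1.2) / (v d.1.2 - v d.1.1)) : ℂ))
      else 0

lemma A_gauge (hre : Function.Injective (fun i => (v i).re)) (hc : NoCross G v)
    {A : Matrix {p : V × V // G.Adj p.1 p.2} {p : V × V // G.Adj p.1 p.2} ℂ} (hA : KWA G v A)
    (d d' : REdge G v × Bool) :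
    A (tau hre d) (tau hre d') = (gg d)⁻¹ * gg d' * ((sweep hre hc).B d d' : ℂ) := by
  rw [hA, ← gauge hre hc d d']
  unfold hexp
  rfl

lemma core [DecidableRel G.Adj] (hre : Function.Injective (fun i => (v i).re))
    (hc : NoCross G v) (θ : Sym2 V → ℝ)
    (A S : Matrix {p : V × V // G.Adj p.1 p.2} {p : V × V // G.Adj p.1 p.2} ℂ) (hA : KWA G v A)
    (hdet : IsUnit (1 - A *
      Matrix.diagonal (fun d : {p : V × V // G.Adj p.1 p.2} =>
        (Real.tanh (θ s(d.1.1, d.1.2)) : ℂ))).det)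
    (hS : S = (1 - A * Matrix.diagonal (fun d : {p : V × V // G.Adj p.1 p.2} =>
        (Real.tanh (θ s(d.1.1, d.1.2)) : ℂ)))⁻¹ * A)
    (p0 : {p : V × V // G.Adj p.1 p.2}) (σ : Sym2 V) (hne : s(p0.1.1, p0.1.2) ≠ σ) :
    HasDerivAt (fun t : ℝ => deriv
          (fun u : ℝ => ((Real.log (partitionFn G (fun _ => 0)
            (Function.update (Function.update θ σ t) s(p0.1.1, p0.1.2) u)) : ℝ) : ℂ))
          (θ s(p0.1.1, p0.1.2)))
      (-((1 - (Real.tanh (θ s(p0.1.1, p0.1.2)) : ℂ) ^ 2) *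
        ∑ d', S p0 d' * ((if s(d'.1.1, d'.1.2) = σ then (1 - (Real.tanh (θ σ) : ℂ) ^ 2) else 0)
          * S d' p0))) (θ σ) := by
  obtain ⟨d0, rfl⟩ := (tau hre).surjective p0
  have hue : ∀ d : REdge G v × Bool, s((tau hre d).1.1, (tau hre d).1.2) = ue d.1 := toD_sym
  rw [hue] at hne ⊢
  set K := sweep hre hc with hK
  obtain ⟨M, hMc, hMeq, hM0⟩ := K.exists_observable d0
  -- weights
  set w : ℝ → REdge G v → ℝ := fun t e => Real.tanh (Function.update θ σ t (ue e)) with hw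
  have hZpos : ∀ t, 0 < K.Zev (w t) := fun t => Zev_pos hre hc _
  set g : ℝ → {p : V × V // G.Adj p.1 p.2} → ℂ :=
    fun t d => (Real.tanh (Function.update θ σ t s(d.1.1, d.1.2)) : ℂ) with hg
  have hg0 : g (θ σ) = fun d => (Real.tanh (θ s(d.1.1, d.1.2)) : ℂ) := by
    funext d; simp only [hg, Function.update_eq_self]
  set X : ℝ → {p : V × V // G.Adj p.1 p.2} → ℂ := fun t p =>
    (gg ((tau hre).symm p))⁻¹ * gg d0 * ((M (w t) ((tau hre).symm p) / K.Zev (w t) : ℝ) : ℂ) with hX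
  have hwc : Continuous w := by
    refine continuous_pi fun e => ?_
    have ht : Continuous Real.tanh :=
      continuous_iff_continuousAt.2 fun x => (hasDerivAt_tanh x).continuousAt
    refine ht.comp ?_
    by_cases h : ue e = σ
    · simp only [h, Function.update_self]; exact continuous_id
    · simp only [Function.update_of_ne h]; exact continuous_const
  have hgd : ∀ d, HasDerivAt (fun t => g t d)
      (if s(d.1.1, d.1.2) = σ then (1 - (Real.tanh (θ σ) : ℂ) ^ 2) else 0) (θ σ) := by
    intro d
    by_cases h : s(d.1.1, d.1.2) = σ
    · rw [if_pos h]
      simp only [hg, h, Function.update_self]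
      have := (hasDerivAt_tanh (θ σ)).ofReal_comp
      push_cast at this ⊢
      exact this
    · rw [if_neg h]
      simp only [hg, Function.update_of_ne h]
      exact hasDerivAt_const _ _
  have hXc : ∀ d, ContinuousAt (fun t => X t d) (θ σ) := by
    intro d
    refine Continuous.continuousAt ?_
    refine continuous_const.mul (Complex.continuous_ofReal.comp ?_)
    exact ((hMc _).comp hwc).div (K.Zev_cont.comp hwc) fun t => (hZpos t).ne'
  have hXeq : ∀ t d, X t d = ∑ d', A d d' * ((if d' = tau hre d0 then 1 else 0) + g t d' * X t d') := by
    intro t p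
    obtain ⟨d, rfl⟩ := (tau hre).surjective p
    rw [← (tau hre).sum_comp]
    have hz : ((K.Zev (w t) : ℝ) : ℂ) ≠ 0 := by exact_mod_cast (hZpos t).ne'
    simp only [hX, Equiv.symm_apply_apply]
    rw [hMeq]
    push_cast
    rw [Finset.sum_div, Finset.mul_sum]
    refine Finset.sum_congr rfl fun d' _ => ?_
    rw [A_gauge hre hc hA, ← hK]
    have hgw : g t (tau hre d') = (w t d'.1 : ℂ) := by simp only [hg, hw, hue]
    rw [hgw]
    have n1 := gg_ne d'
    have n2 := gg_ne d
    by_cases h : d' = d0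
    · subst h
      simp only [if_true]
      field_simp
    · have h' : tau hre d' ≠ tau hre d0 := fun hh => h ((tau hre).injective hh)
      simp only [h, h', if_false]
      field_simp
      push_cast
      ring
  have main := resolvent_deriv A S g _ X (θ σ) (tau hre d0) (by rw [hg0]; exact hdet)
    (by rw [hg0]; exact hS) hgd hXc hXeq (tau hre d0)
  have hfun : (fun t : ℝ => deriv
          (fun u : ℝ => ((Real.log (partitionFn G (fun _ => 0)
            (Function.update (Function.update θ σ t) (ue d0.1) u)) : ℝ) : ℂ))
          (θ (ue d0.1))) = fun t => (Real.tanh (θ (ue d0.1)) : ℂ) +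
            (1 - (Real.tanh (θ (ue d0.1)) : ℂ) ^ 2) * -(X t (tau hre d0)) := by
    funext t
    have h1 := (inner_deriv hre hc (Function.update θ σ t) d0.1).ofReal_comp
    rw [Function.update_of_ne hne] at h1
    rw [h1.deriv]
    simp only [hX, Equiv.symm_apply_apply]
    rw [inv_mul_cancel₀ (gg_ne d0), hM0]
    push_cast
    ring
  rw [hfun]
  refine ((main.neg.const_mul _).const_add _).congr_deriv ?_
  ring

/-- Existence of a generic rotation. -/
lemma exists_rot (hinj : Function.Injective v) :
    ∃ s : ℝ, Function.Injective (fun i => ((1 + s * Complex.I) * v i).re) := by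
  have hfin : (⋃ p : V × V, {s : ℝ | p.1 ≠ p.2 ∧
      ((1 + s * Complex.I) * v p.1).re = ((1 + s * Complex.I) * v p.2).re}).Finite := by
    refine Set.finite_iUnion fun p => ?_
    refine Set.Subsingleton.finite ?_
    rintro s ⟨hp, hs⟩ t ⟨_, ht⟩
    simp at hs ht
    by_cases him : (v p.1).im = (v p.2).im
    · exfalso
      rw [him] at hs
      exact hp (hinj (Complex.ext (by linarith) him))
    · have : (s - t) * ((v p.1).im - (v p.2).im) = 0 := by linarith
      rcases mul_eq_zero.1 this with h | h
      · linarith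
      · exact absurd (by linarith) him
  obtain ⟨s, hs⟩ := hfin.infinite_compl.nonempty
  refine ⟨s, fun i j h => ?_⟩
  by_contra hne
  exact hs (Set.mem_iUnion.2 ⟨(i, j), hne, h⟩)

lemma nocross_rot (hc : NoCross G v) {c : ℂ} (h0 : c ≠ 0) : NoCross G (fun i => c * v i) := by
  intro i j k l hij hkl hne z hz
  have key : ∀ a b, z ∈ segment ℝ (c * v a) (c * v b) → c⁻¹ * z ∈ segment ℝ (v a) (v b) := by
    rintro a b ⟨x, y, hx, hy, hxy, rfl⟩
    refine ⟨x, y, hx, hy, hxy, ?_⟩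
    simp only [Complex.real_smul]
    field_simp
  have := hc i j k l hij hkl hne ⟨key _ _ hz.1, key _ _ hz.2⟩
  have e : ∀ a, c⁻¹ * z = v a ↔ z = c * v a := by
    intro a; rw [inv_mul_eq_iff_eq_mul₀ h0]
  simpa [e] using this

lemma KWA_rot {A : Matrix {p : V × V // G.Adj p.1 p.2} {p : V × V // G.Adj p.1 p.2} ℂ}
    (hA : KWA G v A) {c : ℂ} (h0 : c ≠ 0) : KWA G (fun i => c * v i) A := by
  intro d d'
  rw [hA]
  simp only [← mul_sub]
  rw [mul_div_mul_left _ _ h0]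

end KWgeom
end KWfinal2

/-- Off-diagonal entries of the Hessian of the log-partition function of a
zero-field planar Ising model: with the Kac–Ward matrices `A`, `W = A·D` of a straight-line
planar embedding, `S = (I−W)⁻¹A`, `P` the permutation matrix swapping each directed edge with
its reversal, and `T = (I+P)(S ∘ Sᵀ)(I+Pᵀ)`, one has for distinct edges `{i,j} ≠ {k,l}`:
`∂²Φ(θ)/∂θ_{ij}∂θ_{kl} = −(1/2)(1 − w_{ij}²) T_{(i,j),(k,l)} (1 − w_{kl}²)`. -/
theorem log_partition_hessian_off_diagonal
    (G : SimpleGraph V) [DecidableRel G.Adj]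
    (v : V → ℂ) (hinj : Function.Injective v)
    (hcross : ∀ i j k l : V, G.Adj i j → G.Adj k l → s(i, j) ≠ s(k, l) →
      segment ℝ (v i) (v j) ∩ segment ℝ (v k) (v l) ⊆ ({v i, v j} : Set ℂ) ∩ {v k, v l})
    (hvert : ∀ i j : V, G.Adj i j → ∀ k : V, k ≠ i → k ≠ j →
      v k ∉ openSegment ℝ (v i) (v j))
    (θ : Sym2 V → ℝ)
    (A W S P T : Matrix {p : V × V // G.Adj p.1 p.2} {p : V × V // G.Adj p.1 p.2} ℂ)
    (hA : ∀ d d' : {p : V × V // G.Adj p.1 p.2}, A d d' =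
      if d.1.2 = d'.1.1 ∧ d.1.1 ≠ d'.1.2 then
        Complex.exp (Complex.I / 2 *
          (Complex.arg ((v d'.1.2 - v d.1.2) / (v d.1.2 - v d.1.1)) : ℂ))
      else 0)
    (hW : W = A * Matrix.diagonal (fun d => (Real.tanh (θ s(d.1.1, d.1.2)) : ℂ)))
    (hdet : IsUnit (1 - W).det)
    (hS : S = (1 - W)⁻¹ * A)
    (hP : ∀ d d' : {p : V × V // G.Adj p.1 p.2}, P d d' =
      if d'.1 = (d.1.2, d.1.1) then 1 else 0)
    (hT : T = (1 + P) * Matrix.hadamard S S.transpose * (1 + P.transpose)) :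
    ∀ i j k l : V, ∀ hij : G.Adj i j, ∀ hkl : G.Adj k l, s(i, j) ≠ s(k, l) →
      (deriv (fun t : ℝ => deriv
          (fun u : ℝ => Real.log (partitionFn G (fun _ => 0)
            (Function.update (Function.update θ s(k, l) t) s(i, j) u)))
          (θ s(i, j)))
        (θ s(k, l)) : ℂ)
      = -(1 / 2) * (1 - (Real.tanh (θ s(i, j)) : ℂ) ^ 2) *
          T ⟨(i, j), hij⟩ ⟨(k, l), hkl⟩ * (1 - (Real.tanh (θ s(k, l)) : ℂ) ^ 2) := by
  intro i j k l hij hkl hne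
  obtain ⟨s, hs⟩ := KWgeom.exists_rot hinj
  have hc0 : (1 + s * Complex.I : ℂ) ≠ 0 := by
    intro h
    have := congrArg Complex.re h
    simp at this
  have hA' : KWgeom.KWA G (fun i => (1 + s * Complex.I) * v i) A := KWgeom.KWA_rot hA hc0
  have hcr := KWgeom.nocross_rot (v := v) hcross hc0
  subst hW
  have c1 := KWgeom.core hs hcr θ A S hA' hdet hS ⟨(i, j), hij⟩ s(k, l) hne
  have c2 := KWgeom.core hs hcr θ A S hA' hdet hS ⟨(j, i), hij.symm⟩ s(k, l)
    (by rw [Sym2.eq_swap]; exact hne)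
  simp only [] at c1 c2
  rw [Sym2.eq_swap (a := j) (b := i)] at c2
  rw [c1.deriv]
  have huniq := c1.unique c2
  have hsum : ∀ p0 : {p : V × V // G.Adj p.1 p.2},
      ∑ d', S p0 d' * ((if s(d'.1.1, d'.1.2) = s(k, l) then
        (1 - (Real.tanh (θ s(k, l)) : ℂ) ^ 2) else 0) * S d' p0) =
      (1 - (Real.tanh (θ s(k, l)) : ℂ) ^ 2) * (S p0 ⟨(k, l), hkl⟩ * S ⟨(k, l), hkl⟩ p0 +
        S p0 ⟨(l, k), hkl.symm⟩ * S ⟨(l, k), hkl.symm⟩ p0) := by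
    intro p0
    have hd : (⟨(k, l), hkl⟩ : {p : V × V // G.Adj p.1 p.2}) ≠ ⟨(l, k), hkl.symm⟩ := by
      intro h
      have h1 := congrArg (fun p => p.1.1) h
      exact hkl.ne h1
    rw [← Finset.sum_subset (Finset.subset_univ
      {(⟨(k, l), hkl⟩ : {p : V × V // G.Adj p.1 p.2}), ⟨(l, k), hkl.symm⟩}), Finset.sum_pair hd]
    · rw [if_pos rfl, if_pos Sym2.eq_swap]
      ring
    · rintro ⟨⟨a, b⟩, hab⟩ - hmem
      rw [if_neg]
      · simp
      · intro h
        apply hmem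
        rw [Sym2.eq_iff] at h
        rcases h with ⟨h1, h2⟩ | ⟨h1, h2⟩
        · simp only at h1 h2
          subst h1; subst h2; simp
        · simp only at h1 h2
          subst h1; subst h2; simp
  rw [hsum, hsum] at huniq
  rw [hsum]
  have hPl : ∀ (N : Matrix {p : V × V // G.Adj p.1 p.2} {p : V × V // G.Adj p.1 p.2} ℂ) (a b : V)
      (hab : G.Adj a b) q, (P * N) ⟨(a, b), hab⟩ q = N ⟨(b, a), hab.symm⟩ q := by
    intro N a b hab q
    rw [Matrix.mul_apply, Finset.sum_eq_single ⟨(b, a), hab.symm⟩]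
    · rw [hP]; simp
    · intro d _ hd
      rw [hP, if_neg, zero_mul]
      intro h
      exact hd (Subtype.ext h)
    · intro h; exact absurd (Finset.mem_univ _) h
  have hPr : ∀ (N : Matrix {p : V × V // G.Adj p.1 p.2} {p : V × V // G.Adj p.1 p.2} ℂ) (a b : V)
      (hab : G.Adj a b) q, (N * P.transpose) q ⟨(a, b), hab⟩ = N q ⟨(b, a), hab.symm⟩ := by
    intro N a b hab q
    rw [Matrix.mul_apply, Finset.sum_eq_single ⟨(b, a), hab.symm⟩]
    · rw [Matrix.transpose_apply, hP]; simp
    · intro d _ hd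
      rw [Matrix.transpose_apply, hP, if_neg, mul_zero]
      intro h
      exact hd (Subtype.ext h)
    · intro h; exact absurd (Finset.mem_univ _) h
  have hTv : T ⟨(i, j), hij⟩ ⟨(k, l), hkl⟩ =
      S ⟨(i, j), hij⟩ ⟨(k, l), hkl⟩ * S ⟨(k, l), hkl⟩ ⟨(i, j), hij⟩ +
      S ⟨(j, i), hij.symm⟩ ⟨(k, l), hkl⟩ * S ⟨(k, l), hkl⟩ ⟨(j, i), hij.symm⟩ +
      (S ⟨(i, j), hij⟩ ⟨(l, k), hkl.symm⟩ * S ⟨(l, k), hkl.symm⟩ ⟨(i, j), hij⟩ +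
      S ⟨(j, i), hij.symm⟩ ⟨(l, k), hkl.symm⟩ * S ⟨(l, k), hkl.symm⟩ ⟨(j, i), hij.symm⟩) := by
    rw [hT, mul_add, mul_one, Matrix.add_apply, hPr, add_mul, one_mul, Matrix.add_apply,
      Matrix.add_apply, hPl, hPl]
    simp only [Matrix.hadamard_apply, Matrix.transpose_apply]
  rw [hTv]
  linear_combination (1 / 2 : ℂ) * huniq
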